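/- arXiv:1504.07813 — 2 statements merged into one kernel-verified Lean document; each statement's English description precedes it below -/
import Mathlib

section
/- Let Δ^L(Y) be the determinant of the d×d submatrix of x^L(Y) with rows ι(R) and columns 1,…,d. Then Δ^L(Y) = Σ_{(k^{(s)}_i) satisfying (*)} ∏_{i=1}^{d} ( ∏_{s=1}^{δ_i} C̄(m−l^{(s)}_i, k^{(s)}_i) ) · ( ∏_{s=δ_i+1}^{m−m′} C(m−l^{(s)}_i, |k^{(s)}_i|−1) ), the sum being over all families (k^{(s)}_i)_{1≤s≤m−m′,1≤i≤d} of elements of J satisfying (*), with δ_i and l^{(s)}_i determined from the family as in the definition of (*). In particular Δ^L(Y) is a Laurent polynomial in the variables Y_{s,l} with non-negative integer coefficients. -/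
noncomputable section
open Matrix BigOperators

namespace CTypeMinors

/-- Standard basis vector of `ℂ^{2r}`, indexed by a natural number `a` (0-indexed):
`a = j - 1` encodes the unbarred element `j ∈ J`, and `a = 2r - j` encodes the barred
element `j̄ ∈ J` (this is the bijection `ι` shifted to be 0-indexed; the natural order
on `{0, …, 2r-1}` corresponds to the total order on `J`). -/
def vv (r a : ℕ) : Fin (2*r) → ℂ := fun k => if (k : ℕ) = a then 1 else 0

/-- `v_j` for unbarred `j` (`1 ≤ j ≤ r`); note `vu r (r+1) = v_{r̄}`. -/
def vu (r j : ℕ) : Fin (2*r) → ℂ := vv r (j - 1)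

/-- `v_{j̄}` for barred `j̄` (`1 ≤ j ≤ r`). -/
def vb (r j : ℕ) : Fin (2*r) → ℂ := vv r (2*r - j)

/-- The matrix `f_i` (`1 ≤ i ≤ r`): `f_i v_i = v_{i+1}`, `f_i v_{(i+1)‾} = v_{ī}`
(for `i = r` these two conditions both read `f_r v_r = v_{r̄}`), all other basis
vectors are sent to `0`. -/
def fMat (r i : ℕ) : Matrix (Fin (2*r)) (Fin (2*r)) ℂ :=
  Matrix.of fun k l =>
    if ((l : ℕ) + 1 = i ∧ (k : ℕ) = i) ∨ ((l : ℕ) + i + 1 = 2*r ∧ (k : ℕ) + i = 2*r)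
    then 1 else 0

/-- `e_i = f_iᵀ`. -/
def eMat (r i : ℕ) : Matrix (Fin (2*r)) (Fin (2*r)) ℂ := (fMat r i)ᵀ

/-- `x_i(t) = 1 + t e_i`. -/
def xMat (r i : ℕ) (t : ℂ) : Matrix (Fin (2*r)) (Fin (2*r)) ℂ := 1 + t • eMat r i

/-- `y_i(t) = 1 + t f_i`. -/
def yMat (r i : ℕ) (t : ℂ) : Matrix (Fin (2*r)) (Fin (2*r)) ℂ := 1 + t • fMat r i

/-- `α_i^∨(c)`: diagonal, acting by `c` on `v_i, v_{(i+1)‾}`, by `c⁻¹` on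
`v_{i+1}, v_{ī}`, and by `1` elsewhere (for `i = r`: by `c` on `v_r`, `c⁻¹` on `v_{r̄}`). -/
def alMat (r i : ℕ) (c : ℂ) : Matrix (Fin (2*r)) (Fin (2*r)) ℂ :=
  Matrix.diagonal fun k =>
    if (k : ℕ) + 1 = i ∨ (k : ℕ) + i + 1 = 2*r then c
    else if (k : ℕ) = i ∨ (k : ℕ) + i = 2*r then c⁻¹
    else 1

/-- `x_{-i}(t) = y_i(t) ⬝ α_i^∨(t⁻¹)`. -/
def xmMat (r i : ℕ) (t : ℂ) : Matrix (Fin (2*r)) (Fin (2*r)) ℂ :=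
  yMat r i t * alMat r i t⁻¹

/-- Entry of a `2r × 2r` matrix at (0-indexed) natural number indices. -/
def ent {r : ℕ} (X : Matrix (Fin (2*r)) (Fin (2*r)) ℂ) (a b : ℕ) : ℂ :=
  dotProduct (vv r a) (X.mulVec (vv r b))

/-- Ordered product `g 1 * g 2 * ⋯ * g n` of matrices. -/
def oprod {N : ℕ} (g : ℕ → Matrix (Fin N) (Fin N) ℂ) (n : ℕ) : Matrix (Fin N) (Fin N) ℂ :=
  ((List.range n).map fun l => g (l + 1)).prod

/-- `x^L(Y) = (x_{-1}(Y_{1,1})⋯x_{-r}(Y_{1,r})) ⋯ x_{-1}(Y_{m,1})⋯x_{-d}(Y_{m,d})`. -/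
def xL (r m d : ℕ) (Y : ℕ → ℕ → ℂ) : Matrix (Fin (2*r)) (Fin (2*r)) ℂ :=
  oprod (fun s => oprod (fun l => xmMat r l (Y s l)) (if s = m then d else r)) m

/-- The 0-indexed row `ι(R_i)` for `i : Fin d` (0-indexed `i`): the `i`-th entry
of `R` is `v_{m'+1+i}` when `(i+1) + m' ≤ r` and `v_{(d-i)‾}` otherwise. -/
def rowR (r m' d i : ℕ) : ℕ := if i + 1 + m' ≤ r then m' + i else 2*r + i - d

/-- `Δ^L(Y)`: determinant of the `d × d` submatrix of `x^L(Y)` with rows `ι(R)` and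
columns `1, …, d`. -/
def DeltaL (r m m' d : ℕ) (Y : ℕ → ℕ → ℂ) : ℂ :=
  (Matrix.of fun i j : Fin d => ent (xL r m d Y) (rowR r m' d (i : ℕ)) (j : ℕ)).det

/-- `C̄(l,k) = Y_{l,k-1}/Y_{l,k}`. -/
def Cbar (Y : ℕ → ℕ → ℂ) (l k : ℕ) : ℂ := Y l (k - 1) / Y l k

/-- `C(l,k) = Y_{l,k+1}/Y_{l+1,k}`. -/
def Cc (Y : ℕ → ℕ → ℂ) (l k : ℕ) : ℂ := Y l (k + 1) / Y (l + 1) k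

/-- `|·| : J → ℕ` in the 0-indexed natural encoding of `J`. -/
def absV (r p : ℕ) : ℕ := if p < r then p + 1 else 2*r - p

open Classical in
/-- The Cauchy–Binet formula, with the minors indexed by strictly increasing tuples. -/
theorem det_mul_eq_sum_strictMono {R : Type*} [CommRing R] {d N : ℕ}
    (A : Matrix (Fin d) (Fin N) R) (B : Matrix (Fin N) (Fin d) R) :
    (A * B).det = ∑ K : Fin d → Fin N,
      if StrictMono K then (A.submatrix id K).det * (B.submatrix K id).det else 0 := by
  have expand : (A * B).det =
      ∑ p : Fin d → Fin N, (A.submatrix id p).det * ∏ i, B (p i) i := by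
    simp only [det_apply', mul_apply, Finset.prod_univ_sum, Finset.mul_sum,
      Fintype.piFinset_univ, submatrix_apply, id]
    rw [Finset.sum_comm]
    refine Finset.sum_congr rfl fun p _ => ?_
    rw [Finset.sum_mul]
    refine Finset.sum_congr rfl fun σ _ => ?_
    rw [Finset.prod_mul_distrib, mul_assoc]
  have inj : (∑ p : Fin d → Fin N, (A.submatrix id p).det * ∏ i, B (p i) i) =
      ∑ p : Fin d → Fin N with Function.Injective p,
        (A.submatrix id p).det * ∏ i, B (p i) i := by
    refine (Finset.sum_subset (Finset.filter_subset _ _) fun p _ hp => ?_).symm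
    obtain ⟨i, j, hpij, hij⟩ : ∃ i j, p i = p j ∧ i ≠ j := by
      rw [Finset.mem_filter] at hp
      simpa [Function.Injective] using hp
    rw [det_zero_of_column_eq hij (by simp [hpij]), zero_mul]
  rw [expand, inj, ← Finset.sum_filter]
  simp_rw [det_apply' (B.submatrix _ id), Finset.mul_sum]
  rw [← Finset.sum_product']
  symm
  refine Finset.sum_bij (fun x _ => x.1 ∘ x.2) ?_ ?_ ?_ ?_
  · rintro ⟨K, σ⟩ h
    simp only [Finset.mem_product, Finset.mem_filter, Finset.mem_univ, true_and,
      and_true] at h ⊢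
    exact h.injective.comp σ.injective
  · rintro ⟨K, σ⟩ h ⟨K', σ'⟩ h' he
    simp only [Finset.mem_product, Finset.mem_filter, Finset.mem_univ, true_and,
      and_true] at h h' he
    have hK : K = K' := by
      rw [← h.range_inj h', ← σ.surjective.range_comp K, he, σ'.surjective.range_comp K']
    subst hK
    have : σ = σ' := Equiv.ext fun i => h.injective (congrFun he i)
    rw [this]
  · intro p hp
    have hp' : Function.Injective p := by simpa using hp
    refine ⟨(p ∘ Tuple.sort p, (Tuple.sort p)⁻¹), ?_, ?_⟩
    · simpa using (Tuple.monotone_sort p).strictMono_of_injective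
        (hp'.comp (Tuple.sort p).injective)
    · funext i
      simp
  · rintro ⟨K, σ⟩ h
    have : A.submatrix id (K ∘ σ) = (A.submatrix id K).submatrix id σ := rfl
    simp only [submatrix_apply, id]
    rw [this, det_permute']
    simp only [Function.comp]
    ring

theorem oprod_succ {N : ℕ} (g : ℕ → Matrix (Fin N) (Fin N) ℂ) (n : ℕ) :
    oprod g (n + 1) = oprod g n * g (n + 1) := by
  simp [oprod, List.range_succ]

open Classical in
/-- A minor of an ordered product as a sum over chains of intermediate index tuples. -/
theorem det_submatrix_oprod {N d : ℕ} (g : ℕ → Matrix (Fin N) (Fin N) ℂ) (n : ℕ)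
    (K₁ K₀ : Fin d → Fin N) (h₀ : StrictMono K₀) (h₁ : StrictMono K₁) :
    ((oprod g n).submatrix K₁ K₀).det =
      ∑ P : Fin (n + 1) → Fin d → Fin N,
        if P 0 = K₀ ∧ P (Fin.last n) = K₁ ∧ ∀ t, StrictMono (P t) then
          ∏ t : Fin n, ((g (n - t)).submatrix (P t.succ) (P t.castSucc)).det else 0 := by
  induction n generalizing K₀ with
  | zero =>
    rw [← (Equiv.funUnique (Fin 1) (Fin d → Fin N)).symm.sum_comp]
    simp only [oprod, List.range_zero, List.map_nil, List.prod_nil, Finset.univ_eq_empty,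
      Finset.prod_empty]
    have : ∀ K : Fin d → Fin N, (K = K₀ ∧ K = K₁ ∧ ∀ _ : Fin 1, StrictMono K) ↔
        (K = K₀ ∧ K₀ = K₁) := by
      intro K
      constructor
      · rintro ⟨rfl, rfl, -⟩; exact ⟨rfl, rfl⟩
      · rintro ⟨rfl, rfl⟩; exact ⟨rfl, rfl, fun _ => h₀⟩
    simp only [Equiv.funUnique_symm_apply, uniqueElim_const, this]
    by_cases h : K₀ = K₁
    · subst h
      rw [submatrix_one _ h₀.injective]
      simp
    · simp only [h, and_false, if_false, Finset.sum_const_zero]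
      have : ∃ i, ∀ j, K₁ i ≠ K₀ j := by
        by_contra hc
        push Not at hc
        apply h
        rw [← h₀.range_inj h₁]
        symm
        apply Set.eq_of_subset_of_card_le
        · rintro _ ⟨i, rfl⟩
          obtain ⟨j, hj⟩ := hc i
          exact ⟨j, hj.symm⟩
        · simp [Set.card_range_of_injective h₀.injective,
            Set.card_range_of_injective h₁.injective]
      obtain ⟨i, hi⟩ := this
      exact det_eq_zero_of_row_eq_zero i fun j => by simp [one_apply, hi j]
  | succ n ih =>
    have : (oprod g (n + 1)).submatrix K₁ K₀ =
        (oprod g n).submatrix K₁ id * (g (n + 1)).submatrix id K₀ := by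
      rw [oprod_succ, submatrix_mul _ _ _ id _ Function.bijective_id]
    rw [this, det_mul_eq_sum_strictMono]
    simp only [submatrix_submatrix, Function.comp_id, Function.id_comp]
    rw [← (Fin.consEquiv fun _ : Fin (n + 2) => Fin d → Fin N).sum_comp,
      Fintype.sum_prod_type]
    symm
    rw [Finset.sum_eq_single K₀]
    · simp only [Fin.consEquiv_apply, Fin.cons_zero, true_and, ← Fin.succ_last, Fin.cons_succ,
        Fin.prod_univ_succ, Fin.forall_fin_succ (n := n + 1), h₀]
      have : ∀ K : Fin d → Fin N, (if StrictMono K then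
          ((oprod g n).submatrix K₁ K).det * ((g (n + 1)).submatrix K K₀).det else 0) =
          ∑ P : Fin (n + 1) → Fin d → Fin N, if P 0 = K then
          (if P (Fin.last n) = K₁ ∧ ∀ t, StrictMono (P t) then
          ((g (n + 1)).submatrix K K₀).det *
          ∏ t : Fin n, ((g (n - t)).submatrix (P t.succ) (P t.castSucc)).det else 0) else 0 := by
        intro K
        split_ifs with hK
        · rw [ih K hK, Finset.sum_mul]
          refine Finset.sum_congr rfl fun P _ => ?_
          split_ifs with h1 h2 h3 h4 h5 <;> first | tauto | ring
        · symm
          refine Finset.sum_eq_zero fun P _ => ?_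
          split_ifs with h1 h2
          · exact absurd (h1 ▸ h2.2 0) hK
          · rfl
          · rfl
      simp only [this]
      symm
      rw [Finset.sum_comm]
      refine Finset.sum_congr rfl fun P _ => ?_
      rw [Finset.sum_ite_eq, if_pos (Finset.mem_univ _)]
      simp
    · intro K _ hK
      refine Finset.sum_eq_zero fun P _ => if_neg ?_
      simp [Fin.consEquiv_apply, hK]
    · simp

/-- Matrix coefficient from `p` to `p'` (0-indexed positions in `J`) of a full cycle
`x_{-1}(y 1) ⋯ x_{-r}(y r)`. -/
def stepWeight (r : ℕ) (y : ℕ → ℂ) (p p' : ℕ) : ℂ :=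
  if p < r ∧ p' = p then y p / y (p + 1)
  else if p + 1 < r ∧ p' = p + 1 then 1
  else if r ≤ p + 1 ∧ r ≤ p' ∧ p ≤ p' then y (2 * r - p) / y (2 * r - p' - 1)
  else 0

theorem stepWeight_of_lt {r : ℕ} {y : ℕ → ℂ} {p p' : ℕ} (h : p' < p) :
    stepWeight r y p p' = 0 := by
  unfold stepWeight
  split_ifs <;> first | rfl | omega

theorem stepWeight_of_succ_lt {r : ℕ} {y : ℕ → ℂ} {p p' : ℕ} (hp : p + 1 < r)
    (h : p + 1 < p') : stepWeight r y p p' = 0 := by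
  unfold stepWeight
  split_ifs <;> first | rfl | omega

theorem stepWeight_barred {r : ℕ} {y : ℕ → ℂ} {p p' : ℕ} (hp : r ≤ p + 1) (hp' : r ≤ p')
    (h : p ≤ p') : stepWeight r y p p' = y (2 * r - p) / y (2 * r - p' - 1) := by
  unfold stepWeight
  split_ifs <;> first | rfl | omega

theorem det_eq_zero_of_proportional_columns {R : Type*} [CommRing R] {n : Type*} [Fintype n]
    [DecidableEq n] (M : Matrix n n R) {i j : n} (hij : i ≠ j) (u : n → R) (a b : R)
    (hi : ∀ k, M k i = a * u k) (hj : ∀ k, M k j = b * u k) : M.det = 0 := by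
  have hM : M = (M.updateCol i (a • u)).updateCol j (b • u) := by
    ext k l
    by_cases h1 : l = j
    · subst h1; simp [hj]
    · by_cases h2 : l = i
      · subst h2; simp [h1, hi]
      · simp [h1, h2]
  rw [hM, det_updateCol_smul, updateCol_comm _ hij, det_updateCol_smul,
    det_zero_of_column_eq hij, mul_zero, mul_zero]
  intro k
  simp [updateCol_apply]

open Classical in
theorem det_stepWeight (r : ℕ) (y : ℕ → ℂ) {d : ℕ} (K K' : Fin d → ℕ) (hK : StrictMono K)
    (hK' : StrictMono K') :
    (Matrix.of fun a b => stepWeight r y (K b) (K' a)).det =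
      if ∀ i j, i < j → r ≤ K i + 1 → K' i < K j then ∏ i, stepWeight r y (K i) (K' i)
      else 0 := by
  induction d with
  | zero => simp
  | succ d ih =>
    have ih' := ih (K ∘ Fin.succ) (K' ∘ Fin.succ) (hK.comp (Fin.strictMono_succ))
      (hK'.comp (Fin.strictMono_succ))
    have minor : ((Matrix.of fun a b => stepWeight r y (K b) (K' a)).submatrix Fin.succ
        Fin.succ) = Matrix.of fun a b => stepWeight r y ((K ∘ Fin.succ) b)
          ((K' ∘ Fin.succ) a) := rfl
    have split : (∀ j : Fin d, r ≤ K 0 + 1 → K' 0 < K j.succ) →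
        stepWeight r y (K 0) (K' 0) * (Matrix.of fun a b => stepWeight r y
          ((K ∘ Fin.succ) b) ((K' ∘ Fin.succ) a)).det =
        if ∀ i j, i < j → r ≤ K i + 1 → K' i < K j then ∏ i, stepWeight r y (K i) (K' i)
        else 0 := by
      intro h
      have : (∀ i j, i < j → r ≤ K i + 1 → K' i < K j) ↔
          ∀ i j : Fin d, i < j → r ≤ K i.succ + 1 → K' i.succ < K j.succ := by
        constructor
        · intro H i j hij
          exact H _ _ (Fin.succ_lt_succ_iff.2 hij)
        · intro H i j hij
          obtain ⟨j, rfl⟩ := Fin.exists_succ_eq.2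
            (Fin.pos_iff_ne_zero.1 ((Fin.zero_le i).trans_lt hij))
          induction i using Fin.cases with
          | zero => exact h j
          | succ i => exact H i j (Fin.succ_lt_succ_iff.1 hij)
      rw [ih', if_congr this rfl rfl, Fin.prod_univ_succ]
      simp only [Function.comp]
      split_ifs <;> simp
    by_cases hA : ∀ j : Fin d, K' 0 < K j.succ
    · rw [← split fun j _ => hA j, det_succ_row_zero, Finset.sum_eq_single 0]
      · rw [Fin.succAbove_zero, minor]
        simp
      · intro b _ hb
        obtain ⟨j, rfl⟩ := Fin.exists_succ_eq.2 hb
        simp [stepWeight_of_lt (hA j)]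
      · simp
    push Not at hA
    obtain ⟨j, hj⟩ := hA
    have h0j : K 0 < K j.succ := hK (Fin.succ_pos j)
    by_cases hr : r ≤ K 0 + 1
    · rw [if_neg]
      · have hle : ∀ k, K' 0 ≤ K' k := fun k => hK'.monotone (Fin.zero_le k)
        apply det_eq_zero_of_proportional_columns _ (Fin.succ_ne_zero j).symm
          (fun k => (y (2 * r - K' k - 1))⁻¹) (y (2 * r - K 0)) (y (2 * r - K j.succ))
        · intro k
          have := hle k
          rw [of_apply, stepWeight_barred hr (by omega) (by omega), div_eq_mul_inv]
        · intro k
          have := hle k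
          rw [of_apply, stepWeight_barred (by omega) (by omega) (by omega), div_eq_mul_inv]
      · intro H
        have := H 0 j.succ (Fin.succ_pos j) hr
        omega
    · rw [← split fun _ h => absurd h hr, det_succ_column_zero, Finset.sum_eq_single 0]
      · rw [Fin.succAbove_zero, minor]
        simp
      · intro b _ hb
        have := hK' (Fin.pos_iff_ne_zero.2 hb)
        rw [of_apply, stepWeight_of_succ_lt (by omega) (by omega)]
        simp
      · simp

theorem vv_eq_single {r a : ℕ} (ha : a < 2 * r) : vv r a = Pi.single ⟨a, ha⟩ 1 := by
  funext k
  simp [vv, Pi.single_apply, Fin.ext_iff]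

theorem mulVec_vv {r a : ℕ} (X : Matrix (Fin (2 * r)) (Fin (2 * r)) ℂ) (ha : a < 2 * r) :
    X *ᵥ vv r a = fun k => X k ⟨a, ha⟩ := by
  rw [vv_eq_single ha, mulVec_single_one]
  rfl

theorem ent_eq {r a b : ℕ} (X : Matrix (Fin (2 * r)) (Fin (2 * r)) ℂ) (ha : a < 2 * r)
    (hb : b < 2 * r) : ent X a b = X ⟨a, ha⟩ ⟨b, hb⟩ := by
  rw [ent, mulVec_vv X hb, vv_eq_single ha, single_one_dotProduct]

theorem xmMat_apply (r i : ℕ) (t : ℂ) (k l : Fin (2 * r)) :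
    xmMat r i t k l = ((if k = l then 1 else 0) + t * fMat r i k l) *
      (if (l : ℕ) + 1 = i ∨ (l : ℕ) + i + 1 = 2 * r then t⁻¹
        else if (l : ℕ) = i ∨ (l : ℕ) + i = 2 * r then t else 1) := by
  simp [xmMat, yMat, alMat, mul_diagonal, one_apply]

theorem xmMat_mulVec_source {r i a : ℕ} {t : ℂ} (ht : t ≠ 0) (ha : a + 1 < 2 * r)
    (h : a + 1 = i ∨ a + i + 1 = 2 * r) :
    xmMat r i t *ᵥ vv r a = t⁻¹ • vv r a + vv r (a + 1) := by
  rw [mulVec_vv _ (by omega)]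
  funext k
  rw [xmMat_apply]
  have hf : fMat r i k ⟨a, by omega⟩ = if (k : ℕ) = a + 1 then 1 else 0 := by
    simp only [fMat, of_apply]
    congr 1
    simp only [eq_iff_iff]
    omega
  rw [hf]
  simp only [Fin.ext_iff, h, if_true, Pi.add_apply, Pi.smul_apply, vv, smul_eq_mul]
  split_ifs <;> field_simp

theorem xmMat_mulVec_target {r i a : ℕ} {t : ℂ} (_hi : 1 ≤ i) (_hir : i ≤ r) (ha : a < 2 * r)
    (h : a = i ∨ a + i = 2 * r) : xmMat r i t *ᵥ vv r a = t • vv r a := by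
  rw [mulVec_vv _ ha]
  funext k
  rw [xmMat_apply]
  have hf : fMat r i k ⟨a, ha⟩ = 0 := by
    simp only [fMat, of_apply]
    rw [if_neg]
    omega
  rw [hf]
  simp only [Fin.ext_iff, Pi.smul_apply, vv, smul_eq_mul]
  rw [if_neg (by omega : ¬ (a + 1 = i ∨ a + i + 1 = 2 * r)), if_pos h]
  ring

theorem xmMat_mulVec_fixed {r i a : ℕ} {t : ℂ} (ha : a < 2 * r)
    (h₁ : ¬ (a + 1 = i ∨ a + i + 1 = 2 * r)) (h₂ : ¬ (a = i ∨ a + i = 2 * r)) :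
    xmMat r i t *ᵥ vv r a = vv r a := by
  rw [mulVec_vv _ ha]
  funext k
  rw [xmMat_apply]
  have hf : fMat r i k ⟨a, ha⟩ = 0 := by
    simp only [fMat, of_apply]
    rw [if_neg]
    omega
  rw [hf]
  simp only [Fin.ext_iff, vv]
  rw [if_neg h₁, if_neg h₂]
  ring

section Cycle

variable {r : ℕ} {y : ℕ → ℂ}

theorem oprod_xmMat_succ_mulVec (n : ℕ) (v : Fin (2 * r) → ℂ) :
    oprod (fun l => xmMat r l (y l)) (n + 1) *ᵥ v =
      oprod (fun l => xmMat r l (y l)) n *ᵥ (xmMat r (n + 1) (y (n + 1)) *ᵥ v) := by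
  rw [oprod_succ, mulVec_mulVec]

theorem oprod_xmMat_mulVec_fixed {n a : ℕ} (h₁ : n < a) (h₂ : a + n + 1 < 2 * r) :
    oprod (fun l => xmMat r l (y l)) n *ᵥ vv r a = vv r a := by
  induction n with
  | zero => simp [oprod]
  | succ n ih =>
    rw [oprod_xmMat_succ_mulVec, xmMat_mulVec_fixed (by omega) (by omega) (by omega),
      ih (by omega) (by omega)]

theorem oprod_xmMat_mulVec_self (hy0 : y 0 = 1) {n : ℕ} (h : n < r) :
    oprod (fun l => xmMat r l (y l)) n *ᵥ vv r n = y n • vv r n := by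
  cases n with
  | zero => simp [oprod, hy0]
  | succ n =>
    rw [oprod_xmMat_succ_mulVec, xmMat_mulVec_target (by omega) (by omega) (by omega)
      (Or.inl rfl), mulVec_smul, oprod_xmMat_mulVec_fixed (by omega) (by omega)]

theorem oprod_xmMat_mulVec_bar_succ (hy0 : y 0 = 1) (hne : ∀ l, 1 ≤ l → l ≤ r → y l ≠ 0)
    {n : ℕ} (h : n < r) :
    oprod (fun l => xmMat r l (y l)) n *ᵥ vv r (2 * r - n - 1) =
      ∑ k ∈ Finset.range (n + 1), (y k)⁻¹ • vv r (2 * r - k - 1) := by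
  induction n with
  | zero => simp [oprod, hy0]
  | succ n ih =>
    rw [oprod_xmMat_succ_mulVec, xmMat_mulVec_source (hne _ (by omega) (by omega))
      (by omega) (by omega), mulVec_add, mulVec_smul,
      oprod_xmMat_mulVec_fixed (by omega) (by omega),
      show 2 * r - (n + 1) - 1 + 1 = 2 * r - n - 1 by omega, ih (by omega),
      Finset.sum_range_succ _ (n + 1), add_comm]

theorem oprod_xmMat_mulVec_bar (hy0 : y 0 = 1) (hne : ∀ l, 1 ≤ l → l ≤ r → y l ≠ 0)
    {n j : ℕ} (hj : 1 ≤ j) (hjn : j ≤ n) (h : n ≤ r) :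
    oprod (fun l => xmMat r l (y l)) n *ᵥ vv r (2 * r - j) =
      y j • ∑ k ∈ Finset.range j, (y k)⁻¹ • vv r (2 * r - k - 1) := by
  induction n, hjn using Nat.le_induction with
  | base =>
    obtain ⟨j, rfl⟩ : ∃ i, j = i + 1 := ⟨j - 1, by omega⟩
    rw [oprod_xmMat_succ_mulVec, xmMat_mulVec_target (by omega) (by omega) (by omega)
      (by omega), mulVec_smul, ← oprod_xmMat_mulVec_bar_succ hy0 hne (by omega),
      show 2 * r - (j + 1) = 2 * r - j - 1 by omega]
  | succ n hjn ih =>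
    rw [oprod_xmMat_succ_mulVec, xmMat_mulVec_fixed (by omega) (by omega) (by omega),
      ih (by omega)]

theorem oprod_xmMat_mulVec_stable {n n' j : ℕ} (hj : j < n) (hn : n ≤ n') (h : n' ≤ r) :
    oprod (fun l => xmMat r l (y l)) n' *ᵥ vv r j =
      oprod (fun l => xmMat r l (y l)) n *ᵥ vv r j := by
  induction n', hn using Nat.le_induction with
  | base => rfl
  | succ n' hn ih =>
    rw [oprod_xmMat_succ_mulVec, xmMat_mulVec_fixed (by omega) (by omega) (by omega),
      ih (by omega)]

theorem oprod_xmMat_apply (hy0 : y 0 = 1) (hyr : y (r + 1) = 1)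
    (hne : ∀ l, 1 ≤ l → l ≤ r → y l ≠ 0) (k l : Fin (2 * r)) :
    oprod (fun l => xmMat r l (y l)) r k l = stepWeight r y l k := by
  obtain ⟨l, hl⟩ := l
  have hcol : oprod (fun l => xmMat r l (y l)) r k ⟨l, hl⟩ =
      (oprod (fun l => xmMat r l (y l)) r *ᵥ vv r l) k := by rw [mulVec_vv _ hl]
  have hk := k.isLt
  have hsum : ∀ n, n ≤ r → (∑ i ∈ Finset.range n, (y i)⁻¹ • vv r (2 * r - i - 1)) k =
      if 2 * r - n ≤ k then (y (2 * r - k - 1))⁻¹ else 0 := by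
    intro n hn
    simp only [Finset.sum_apply, Pi.smul_apply, vv, smul_eq_mul, mul_ite, mul_one, mul_zero]
    split_ifs with h
    · rw [Finset.sum_eq_single (2 * r - k - 1)]
      · rw [if_pos (by omega)]
      · intro b _ hb
        rw [if_neg]
        rintro h'
        rw [Finset.mem_range] at *
        omega
      · intro hb
        rw [Finset.mem_range] at hb
        omega
    · refine Finset.sum_eq_zero fun i hi => if_neg ?_
      rw [Finset.mem_range] at hi
      omega
  rw [hcol]
  by_cases h : l < r
  · rw [oprod_xmMat_mulVec_stable (n := l + 1) (by omega) (by omega) le_rfl,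
      oprod_xmMat_succ_mulVec, xmMat_mulVec_source (hne _ (by omega) (by omega))
      (by omega) (Or.inl rfl), mulVec_add, mulVec_smul, oprod_xmMat_mulVec_self hy0 h]
    by_cases h' : l + 1 < r
    · rw [oprod_xmMat_mulVec_fixed (by omega) (by omega)]
      simp only [Pi.add_apply, Pi.smul_apply, vv, smul_eq_mul, stepWeight]
      split_ifs <;> first | omega | simp [div_eq_mul_inv, mul_comm]
    · obtain rfl : r = l + 1 := by omega
      have := oprod_xmMat_mulVec_bar_succ hy0 hne h
      rw [show 2 * (l + 1) - l - 1 = l + 1 by omega] at this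
      rw [this]
      simp only [Pi.add_apply, hsum _ le_rfl, Pi.smul_apply, vv, smul_eq_mul, stepWeight,
        show 2 * (l + 1) - l = l + 1 + 1 by omega, hyr]
      split_ifs <;> first | omega | simp [div_eq_mul_inv, mul_comm]
  · obtain ⟨j, hj, rfl⟩ : ∃ j, 1 ≤ j ∧ l = 2 * r - j := ⟨2 * r - l, by omega, by omega⟩
    rw [oprod_xmMat_mulVec_bar hy0 hne hj (by omega) le_rfl, Pi.smul_apply, hsum _ (by omega)]
    simp only [smul_eq_mul, stepWeight, show 2 * r - (2 * r - j) = j by omega]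
    split_ifs <;> first | omega | simp [div_eq_mul_inv]

end Cycle

/-- Families of `d` lattice paths in `{0, …, 2r-1}`: row `i` starts at `i`, has reached `R i` at
time `m`, moves by at most one step while it is unbarred, and rows are non-intersecting. -/
structure PathFamily (r m d : ℕ) (R : ℕ → ℕ) (P : ℕ → ℕ → ℕ) : Prop where
  start : ∀ i, i < d → P 0 i = i
  finish : ∀ i, i < d → ∀ t, m ≤ t → P t i = R i
  mono : ∀ i, i < d → ∀ t, P t i ≤ P (t + 1) i
  step : ∀ i, i < d → ∀ t, P t i + 1 < r → P (t + 1) i ≤ P t i + 1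
  strict : ∀ i, i + 1 < d → ∀ t, P t i < P t (i + 1)
  interlace : ∀ i, i + 1 < d → ∀ t, r ≤ P (t + 1) i → P (t + 1) i < P t (i + 1)

/-- Tableaux with `n` layers, bounded by `R`: strictly increasing along each layer, weakly
increasing across layers, and extended by `R` from layer `n` on. -/
structure IsTableau (n d : ℕ) (R : ℕ → ℕ) (F : ℕ → ℕ → ℕ) : Prop where
  finish : ∀ i, i < d → ∀ s, n ≤ s → F s i = R i
  mono : ∀ i, i < d → ∀ s, F s i ≤ F (s + 1) i
  strict : ∀ i, i + 1 < d → ∀ s, F s i < F s (i + 1)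

/-- The tableau recording the positions at which the rows of a path family pause. -/
def pathToTableau (r : ℕ) (P : ℕ → ℕ → ℕ) (s i : ℕ) : ℕ :=
  Nat.findGreatest (fun y => y ≤ P (s + min y r - i) i) (2 * r - 1)

/-- The path family whose pauses are recorded by a tableau. -/
def tableauToPath (r : ℕ) (F : ℕ → ℕ → ℕ) (t i : ℕ) : ℕ :=
  Nat.findGreatest (fun y => min y r ≤ t + i ∧ y ≤ F (t + i - min y r) i) (2 * r - 1)

theorem le_findGreatest_iff {Q : ℕ → Prop} [DecidablePred Q] {b y : ℕ} (h0 : Q 0)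
    (hdown : ∀ y, Q (y + 1) → Q y) (hb : ∀ y, Q y → y ≤ b) :
    y ≤ Nat.findGreatest Q b ↔ Q y := by
  constructor
  · intro h
    have hQ : Q (Nat.findGreatest Q b) := Nat.findGreatest_spec (Nat.zero_le b) h0
    generalize Nat.findGreatest Q b = z at h hQ
    induction z, h using Nat.le_induction with
    | base => exact hQ
    | succ z _ ih => exact ih (hdown z hQ)
  · intro h
    exact Nat.le_findGreatest (hb y h) h

section Rows

variable {r m m' d n : ℕ} {R : ℕ → ℕ} {P F : ℕ → ℕ → ℕ}

namespace PathFamily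

theorem monotone (hP : PathFamily r m d R P) {i : ℕ} (hi : i < d) : Monotone (P · i) :=
  monotone_nat_of_le_succ (hP.mono i hi)

theorem le_finish (hP : PathFamily r m d R P) {i : ℕ} (hi : i < d) (t : ℕ) : P t i ≤ R i := by
  rw [← hP.finish i hi (max t m) (le_max_right _ _)]
  exact hP.monotone hi (le_max_left _ _)

theorem min_le (hP : PathFamily r m d R P) {i : ℕ} (hi : i < d) (t : ℕ) :
    min (P t i) r ≤ t + i := by
  induction t with
  | zero =>
    have := hP.start i hi
    omega
  | succ t ih =>
    by_cases h : P t i + 1 < r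
    · have := hP.step i hi t h
      omega
    · omega

theorem le_pathToTableau (hP : PathFamily r m d R P) (hR : ∀ i, i < d → R i < 2 * r)
    {i : ℕ} (hi : i < d) (s y : ℕ) :
    y ≤ pathToTableau r P s i ↔ y ≤ P (s + min y r - i) i := by
  unfold pathToTableau
  apply le_findGreatest_iff (Q := fun y => y ≤ P (s + min y r - i) i) (Nat.zero_le _)
  · intro y hy
    have hs := hP.start i hi
    by_cases hyr : y < r
    · rw [min_eq_left (by omega)] at hy ⊢
      by_cases his : i ≤ s + y
      · rw [show s + (y + 1) - i = s + y - i + 1 by omega] at hy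
        by_contra hlt
        have := hP.step i hi (s + y - i) (by omega)
        omega
      · rw [show s + y - i = 0 by omega, hs]
        omega
    · rw [min_eq_right (by omega)] at hy ⊢
      omega
  · intro y hy
    have := hP.le_finish hi (s + min y r - i)
    have := hR i hi
    omega

theorem eq_finish_of_le (hP : PathFamily r m d R P) (hdr : d ≤ r) (hm'r : m' ≤ r) (hnm : n + m' = m)
    (hRb : ∀ i, i < d → r < i + 1 + m' → R i = 2 * r + i - d) {i : ℕ} (hi : i < d)
    (him : r < i + 1 + m') (t : ℕ) (ht : n + r - i ≤ t) : P t i = R i := by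
  induction i generalizing t with
  | zero => exact hP.finish 0 hi t (by omega)
  | succ i ih =>
    by_cases him' : r < i + 1 + m'
    · have h1 := ih (by omega) him' (t + 1) (by omega)
      have h2 := hP.interlace i hi t
      have h3 := hP.le_finish hi t
      rw [hRb i (by omega) him'] at h1
      rw [hRb _ hi him] at h3 ⊢
      omega
    · exact hP.finish _ hi t (by omega)

theorem isTableau (hP : PathFamily r m d R P) (hR : ∀ i, i < d → R i < 2 * r)
    (hdr : d ≤ r) (hm'r : m' ≤ r) (hnm : n + m' = m)
    (hRu : ∀ i, i < d → i + 1 + m' ≤ r → R i = m' + i)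
    (hRb : ∀ i, i < d → r < i + 1 + m' → R i = 2 * r + i - d) :
    IsTableau n d R (pathToTableau r P) where
  finish i hi s hs := by
    apply le_antisymm
    · exact ((hP.le_pathToTableau hR hi s _).1 le_rfl).trans (hP.le_finish hi _)
    · rw [hP.le_pathToTableau hR hi]
      by_cases him : i + 1 + m' ≤ r
      · have := hRu i hi him
        rw [hP.finish i hi]
        omega
      · have := hRb i hi (by omega)
        rw [hP.eq_finish_of_le hdr hm'r hnm hRb hi (by omega)]
        omega
  mono i hi s := by
    rw [hP.le_pathToTableau hR hi]
    refine ((hP.le_pathToTableau hR hi s _).1 le_rfl).trans (hP.monotone hi ?_)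
    omega
  strict i hi s := by
    have h := (hP.le_pathToTableau hR (by omega : i < d) s _).1 le_rfl
    rw [← Nat.succ_le_iff, hP.le_pathToTableau hR hi]
    generalize pathToTableau r P s i = y at h
    by_cases hy : y < r
    · rw [min_eq_left (by omega)] at h ⊢
      rw [show s + y.succ - (i + 1) = s + y - i by omega]
      exact Nat.succ_le_of_lt (h.trans_lt (hP.strict i hi _))
    · rw [min_eq_right (by omega)] at h ⊢
      rw [show s + r - i = s + r - (i + 1) + 1 by omega] at h
      exact Nat.succ_le_of_lt (h.trans_lt (hP.interlace i hi _ (by omega)))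

end PathFamily

namespace IsTableau

theorem monotone (hF : IsTableau n d R F) {i : ℕ} (hi : i < d) : Monotone (F · i) :=
  monotone_nat_of_le_succ (hF.mono i hi)

theorem le_finish (hF : IsTableau n d R F) {i : ℕ} (hi : i < d) (s : ℕ) : F s i ≤ R i := by
  rw [← hF.finish i hi (max s n) (le_max_right _ _)]
  exact hF.monotone hi (le_max_left _ _)

theorem le_apply (hF : IsTableau n d R F) {i : ℕ} (hi : i < d) (s : ℕ) : i ≤ F s i := by
  induction i with
  | zero => exact Nat.zero_le _
  | succ i ih => exact Nat.succ_le_of_lt ((ih (by omega)).trans_lt (hF.strict i hi s))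

theorem le_tableauToPath (hF : IsTableau n d R F) (hR : ∀ i, i < d → R i < 2 * r)
    {i : ℕ} (hi : i < d) (t y : ℕ) :
    y ≤ tableauToPath r F t i ↔ min y r ≤ t + i ∧ y ≤ F (t + i - min y r) i := by
  unfold tableauToPath
  apply le_findGreatest_iff (Q := fun y => min y r ≤ t + i ∧ y ≤ F (t + i - min y r) i)
    ⟨by simp, Nat.zero_le _⟩
  · rintro y ⟨h1, h2⟩
    refine ⟨by omega, (Nat.le_of_succ_le h2).trans (hF.monotone hi ?_)⟩
    omega
  · rintro y ⟨-, hy⟩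
    have := hF.le_finish hi (t + i - min y r)
    have := hR i hi
    omega

theorem pathFamily (hF : IsTableau n d R F) (hR : ∀ i, i < d → R i < 2 * r)
    (hdr : d ≤ r) (hnm : n + m' = m)
    (hRu : ∀ i, i < d → i + 1 + m' ≤ r → R i = m' + i)
    (hRb : ∀ i, i < d → r < i + 1 + m' → R i = 2 * r + i - d) :
    PathFamily r m d R (tableauToPath r F) where
  start i hi := by
    apply le_antisymm
    · have := ((hF.le_tableauToPath hR hi 0 _).1 le_rfl).1
      omega
    · rw [hF.le_tableauToPath hR hi]
      exact ⟨by omega, hF.le_apply hi _⟩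
  finish i hi t ht := by
    apply le_antisymm
    · exact ((hF.le_tableauToPath hR hi t _).1 le_rfl).2.trans (hF.le_finish hi _)
    · rw [hF.le_tableauToPath hR hi]
      by_cases him : i + 1 + m' ≤ r
      · have := hRu i hi him
        rw [hF.finish i hi _ (by omega)]
        omega
      · have := hRb i hi (by omega)
        rw [hF.finish i hi _ (by omega)]
        omega
  mono i hi t := by
    obtain ⟨h1, h2⟩ := (hF.le_tableauToPath hR hi t _).1 le_rfl
    rw [hF.le_tableauToPath hR hi]
    exact ⟨by omega, h2.trans (hF.monotone hi (by omega))⟩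
  step i hi t h := by
    by_contra hlt
    obtain ⟨h1, h2⟩ := (hF.le_tableauToPath hR hi (t + 1) (tableauToPath r F t i + 2)).1
      (by omega)
    have : tableauToPath r F t i + 1 ≤ tableauToPath r F t i := by
      rw [hF.le_tableauToPath hR hi]
      generalize tableauToPath r F t i = y at *
      rw [min_eq_left (by omega)] at h1 h2 ⊢
      rw [show t + 1 + i - (y + 2) = t + i - (y + 1) by omega] at h2
      omega
    omega
  strict i hi t := by
    obtain ⟨h1, h2⟩ := (hF.le_tableauToPath hR (by omega : i < d) t _).1 le_rfl
    rw [← Nat.succ_le_iff, hF.le_tableauToPath hR hi]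
    generalize tableauToPath r F t i = y at *
    have h3 := hF.strict i hi (t + i - min y r)
    have h4 : F (t + i - min y r) (i + 1) ≤ F (t + (i + 1) - min y.succ r) (i + 1) :=
      hF.monotone hi (by omega)
    omega
  interlace i hi t h := by
    obtain ⟨h1, h2⟩ := (hF.le_tableauToPath hR (by omega : i < d) (t + 1) _).1 le_rfl
    rw [← Nat.succ_le_iff, hF.le_tableauToPath hR hi]
    generalize tableauToPath r F (t + 1) i = y at *
    have h3 := hF.strict i hi (t + 1 + i - min y r)
    rw [min_eq_right h] at *
    rw [min_eq_right (by omega), show t + (i + 1) - r = t + 1 + i - r by omega]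
    omega

end IsTableau

theorem tableauToPath_pathToTableau (hP : PathFamily r m d R P)
    (hF : IsTableau n d R (pathToTableau r P))
    (hR : ∀ i, i < d → R i < 2 * r) {i : ℕ} (hi : i < d) (t : ℕ) :
    tableauToPath r (pathToTableau r P) t i = P t i := by
  refine eq_of_forall_le_iff fun y => ?_
  rw [hF.le_tableauToPath hR hi, hP.le_pathToTableau hR hi]
  constructor
  · rintro ⟨h1, h2⟩
    rwa [show t + i - min y r + min y r - i = t by omega] at h2
  · intro h
    have := hP.min_le hi t
    have h1 : min y r ≤ t + i := by omega
    rw [show t + i - min y r + min y r - i = t by omega]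
    exact ⟨h1, h⟩

theorem pathToTableau_tableauToPath (hF : IsTableau n d R F)
    (hP : PathFamily r m d R (tableauToPath r F))
    (hR : ∀ i, i < d → R i < 2 * r) (hdr : d ≤ r) {i : ℕ} (hi : i < d) (s : ℕ) :
    pathToTableau r (tableauToPath r F) s i = F s i := by
  refine eq_of_forall_le_iff fun y => ?_
  rw [hP.le_pathToTableau hR hi, hF.le_tableauToPath hR hi]
  by_cases h : i ≤ s + min y r
  · rw [show s + min y r - i + i - min y r = s by omega]
    exact and_iff_right (by omega)
  · have h1 := hF.le_apply hi s
    have h2 := hF.le_apply hi (s + min y r - i + i - min y r)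
    omega

end Rows

/-- The factor contributed by a pause at position `p` after `t` steps. -/
def pauseWeight (r m : ℕ) (Y : ℕ → ℕ → ℂ) (t p : ℕ) : ℂ :=
  if p < r then Cbar Y (m - t) (p + 1) else Cc Y (m - t) (2 * r - p - 1)

section Weights

variable {r m m' d n : ℕ} {R : ℕ → ℕ} {P F : ℕ → ℕ → ℕ} {Y : ℕ → ℕ → ℂ}

theorem PathFamily.prod_stepWeight (hP : PathFamily r m d R P)
    (hR : ∀ i, i < d → R i < 2 * r) (hdr : d ≤ r) (hYr1 : ∀ s, Y s (r + 1) = 1)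
    {i : ℕ} (hi : i < d) {k : ℕ} (hk : k ≤ m) :
    ∏ t ∈ Finset.range k, stepWeight r (Y (m - t)) (P t i) (P (t + 1) i) =
      (∏ t ∈ Finset.range k with P (t + 1) i = P t i ∨ r ≤ P t i,
        pauseWeight r m Y t (P t i)) *
      if r ≤ P k i then (Y (m - k + 1) (2 * r - P k i - 1))⁻¹ else 1 := by
  rw [Finset.prod_filter]
  induction k with
  | zero =>
    have := hP.start i hi
    rw [if_neg (by omega)]
    simp
  | succ k ih =>
    have h1 := hP.mono i hi k
    have h2 := hP.step i hi k
    have h3 := hP.le_finish hi k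
    have h4 := hR i hi
    rw [Finset.prod_range_succ, Finset.prod_range_succ, ih (by omega),
      show m - (k + 1) + 1 = m - k by omega]
    generalize P k i = p at *
    generalize P (k + 1) i = p' at *
    rcases lt_trichotomy (p + 1) r with h | h | h
    · obtain rfl | rfl : p' = p ∨ p' = p + 1 := by have := h2 h; omega
      · simp [stepWeight, pauseWeight, Cbar, show p' < r by omega, show ¬ r ≤ p' by omega]
      · simp [stepWeight, show ¬ r ≤ p by omega, show ¬ r ≤ p + 1 by omega, h]
    · obtain rfl | h5 : p' = p ∨ r ≤ p' := by omega
      · simp [stepWeight, pauseWeight, Cbar, show p' < r by omega, show ¬ r ≤ p' by omega]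
      · rw [stepWeight_barred (by omega) h5 h1, show 2 * r - p = r + 1 by omega, hYr1,
          if_neg (by omega), if_neg (by omega), if_pos h5]
        simp
    · rw [stepWeight_barred (by omega) (by omega) h1, if_pos (by omega), if_pos (by omega),
        if_pos (by omega), pauseWeight, if_neg (by omega), Cc,
        show 2 * r - p - 1 + 1 = 2 * r - p by omega]
      ring

/-- Reindexing the pauses of a row by the layers of the tableau. -/
theorem prod_pauseWeight (hP : PathFamily r m d R P) (hF : IsTableau n d R F)
    (hconj : ∀ i, i < d → ∀ s y, y ≤ F s i ↔ y ≤ P (s + min y r - i) i)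
    (hdr : d ≤ r) (hnm : n + m' = m)
    (hRu : ∀ i, i < d → i + 1 + m' ≤ r → R i = m' + i)
    (hRb : ∀ i, i < d → r < i + 1 + m' → R i = 2 * r + i - d) {i : ℕ} (hi : i < d) :
    ∏ t ∈ Finset.range m with P (t + 1) i = P t i ∨ r ≤ P t i, pauseWeight r m Y t (P t i) =
      ∏ s ∈ Finset.range (n + (m' + i - r)),
        pauseWeight r m Y (min (F s i) r + s - i) (F s i) := by
  have pause : ∀ s, P (min (F s i) r + s - i) i = F s i ∧
      (F s i < r → P (min (F s i) r + s - i + 1) i = F s i) := by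
    intro s
    have h1 := (hconj i hi s _).1 le_rfl
    have h2 := mt (hconj i hi s (F s i + 1)).2 (by omega)
    have h3 := hF.le_apply hi s
    have h4 := hP.mono i hi (s + min (F s i) r - i)
    rw [add_comm _ s]
    by_cases h : F s i < r
    · rw [show s + min (F s i + 1) r - i = s + min (F s i) r - i + 1 by omega] at h2
      omega
    · rw [show s + min (F s i + 1) r - i = s + min (F s i) r - i by omega] at h2
      omega
  have layer : ∀ t, P (t + 1) i = P t i ∨ r ≤ P t i →
      F (t + i - min (P t i) r) i = P t i := by
    intro t ht
    have h0 := hP.min_le hi t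
    have h1 := (hconj i hi (t + i - min (P t i) r) (P t i)).2
    have h2 := (hconj i hi (t + i - min (P t i) r) (P t i + 1)).1
    rw [show t + i - min (P t i) r + min (P t i) r - i = t by omega] at h1
    by_cases h : r ≤ P t i
    · rw [show t + i - min (P t i) r + min (P t i + 1) r - i = t by omega] at h2
      omega
    · rw [show t + i - min (P t i) r + min (P t i + 1) r - i = t + 1 by omega] at h2
      omega
  refine Finset.prod_bij' (fun t _ => t + i - min (P t i) r)
    (fun s _ => min (F s i) r + s - i) ?_ ?_ ?_ ?_ ?_
  · intro t ht
    rw [Finset.mem_filter, Finset.mem_range] at ht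
    rw [Finset.mem_range]
    by_contra hlt
    have h1 := layer t ht.2
    have h0 := hP.min_le hi t
    rw [hF.finish i hi _ (by omega)] at h1
    by_cases him : i + 1 + m' ≤ r
    · have := hRu i hi him
      omega
    · have := hRb i hi (by omega)
      omega
  · intro s hs
    rw [Finset.mem_range] at hs
    rw [Finset.mem_filter, Finset.mem_range]
    have h1 := pause s
    have h2 := hF.le_finish hi s
    have h3 := hF.le_apply hi s
    refine ⟨?_, by omega⟩
    by_cases him : i + 1 + m' ≤ r
    · have := hRu i hi him
      omega
    · omega
  · intro t ht
    rw [Finset.mem_filter, Finset.mem_range] at ht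
    have h0 := hP.min_le hi t
    simp only [layer t ht.2]
    omega
  · intro s _
    have h3 := hF.le_apply hi s
    simp only [(pause s).1]
    omega
  · intro t ht
    rw [Finset.mem_filter, Finset.mem_range] at ht
    have h0 := hP.min_le hi t
    rw [layer t ht.2]
    congr 1
    omega

/-- The factor `∏ Y_{a, d-i}` relating the weights of a path and of the tableau row it defines. -/
def frozenWeight (r m' d : ℕ) (Y : ℕ → ℕ → ℂ) (i : ℕ) : ℂ :=
  ∏ b ∈ Finset.range (m' + i - r), Y (b + 1) (d - i)

theorem frozenWeight_ne_zero (hdr : d ≤ r) (hm'm : m' ≤ m) (hY0 : ∀ s, Y s 0 = 1)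
    (hYne : ∀ s l, 1 ≤ s → s ≤ m → 1 ≤ l → l ≤ r → Y s l ≠ 0) {i : ℕ} (hi : i ≤ d) :
    frozenWeight r m' d Y i ≠ 0 := by
  refine Finset.prod_ne_zero_iff.2 fun b hb => ?_
  rw [Finset.mem_range] at hb
  by_cases h : d - i = 0
  · rw [h, hY0]
    exact one_ne_zero
  · exact hYne _ _ (by omega) (by omega) (by omega) (by omega)

theorem prod_pauseWeight_frozen (hF : IsTableau n d R F) (hdr : d ≤ r) (hm'r : m' ≤ r)
    (hnm : n + m' = m) (hm' : 1 ≤ m')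
    (hRu : ∀ i, i < d → i + 1 + m' ≤ r → R i = m' + i)
    (hRb : ∀ i, i < d → r < i + 1 + m' → R i = 2 * r + i - d) {i : ℕ} (hi : i < d) :
    (∏ b ∈ Finset.range (m' + i - r),
        pauseWeight r m Y (min (F (n + b) i) r + (n + b) - i) (F (n + b) i)) *
      (if r ≤ R i then (Y 1 (2 * r - R i - 1))⁻¹ else 1) =
      frozenWeight r m' d Y i / frozenWeight r m' d Y (i + 1) := by
  unfold frozenWeight
  by_cases him : i + 1 + m' ≤ r
  · have := hRu i hi him
    rw [if_neg (by omega), show m' + i - r = 0 by omega, show m' + (i + 1) - r = 0 by omega]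
    simp
  · have hRi := hRb i hi (by omega)
    rw [if_pos (by omega), show m' + (i + 1) - r = m' + i - r + 1 by omega,
      Finset.prod_range_succ' (n := m' + i - r), mul_comm (∏ k ∈ _, Y _ _), ← div_div,
      div_eq_mul_inv _ (Y (0 + 1) _), mul_div_right_comm, ← Finset.prod_div_distrib,
      ← Finset.prod_range_reflect (fun b => Y (b + 1) (d - i) / Y (b + 1 + 1) (d - (i + 1)))]
    rw [show 2 * r - R i - 1 = d - (i + 1) by omega, zero_add]
    congr 1
    refine Finset.prod_congr rfl fun b hb => ?_
    rw [Finset.mem_range] at hb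
    rw [hF.finish i hi _ (by omega), pauseWeight, if_neg (by omega), Cc]
    congr 2 <;> omega

theorem prod_frozenWeight_div (hdr : d ≤ r) (hm'm : m' ≤ m) (hm'r : m' ≤ r)
    (hY0 : ∀ s, Y s 0 = 1)
    (hYne : ∀ s l, 1 ≤ s → s ≤ m → 1 ≤ l → l ≤ r → Y s l ≠ 0) :
    ∏ i ∈ Finset.range d, frozenWeight r m' d Y i / frozenWeight r m' d Y (i + 1) = 1 := by
  have telescope : ∀ k, k ≤ d → ∏ i ∈ Finset.range k,
      frozenWeight r m' d Y i / frozenWeight r m' d Y (i + 1) =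
        frozenWeight r m' d Y 0 / frozenWeight r m' d Y k := by
    intro k hk
    induction k with
    | zero => rw [Finset.prod_range_zero,
        div_self (frozenWeight_ne_zero hdr hm'm hY0 hYne (Nat.zero_le d))]
    | succ k ih =>
      rw [Finset.prod_range_succ, ih (by omega),
        div_mul_div_cancel₀ (frozenWeight_ne_zero hdr hm'm hY0 hYne (by omega))]
  rw [telescope d le_rfl]
  simp [frozenWeight, hY0, show m' - r = 0 by omega]

theorem prod_stepWeight_eq_prod_pauseWeight (hP : PathFamily r m d R P)
    (hF : IsTableau n d R F)
    (hconj : ∀ i, i < d → ∀ s y, y ≤ F s i ↔ y ≤ P (s + min y r - i) i)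
    (hR : ∀ i, i < d → R i < 2 * r) (hdr : d ≤ r) (hm'r : m' ≤ r) (hnm : n + m' = m)
    (hm' : 1 ≤ m')
    (hRu : ∀ i, i < d → i + 1 + m' ≤ r → R i = m' + i)
    (hRb : ∀ i, i < d → r < i + 1 + m' → R i = 2 * r + i - d)
    (hY0 : ∀ s, Y s 0 = 1) (hYr1 : ∀ s, Y s (r + 1) = 1)
    (hYne : ∀ s l, 1 ≤ s → s ≤ m → 1 ≤ l → l ≤ r → Y s l ≠ 0) :
    ∏ i ∈ Finset.range d, ∏ t ∈ Finset.range m,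
        stepWeight r (Y (m - t)) (P t i) (P (t + 1) i) =
      ∏ i ∈ Finset.range d, ∏ s ∈ Finset.range n,
        pauseWeight r m Y (min (F s i) r + s - i) (F s i) := by
  rw [← mul_one (∏ i ∈ Finset.range d, ∏ s ∈ Finset.range n, _),
    ← prod_frozenWeight_div hdr (by omega : m' ≤ m) hm'r hY0 hYne, ← Finset.prod_mul_distrib]
  refine Finset.prod_congr rfl fun i hi => ?_
  rw [Finset.mem_range] at hi
  rw [hP.prod_stepWeight hR hdr hYr1 hi le_rfl,
    prod_pauseWeight hP hF hconj hdr hnm hRu hRb hi, Finset.prod_range_add,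
    ← prod_pauseWeight_frozen hF hdr hm'r hnm hm' hRu hRb hi, hP.finish i hi m le_rfl,
    Nat.sub_self, zero_add, mul_assoc]

end Weights

theorem oprod_congr {N n : ℕ} {g g' : ℕ → Matrix (Fin N) (Fin N) ℂ}
    (h : ∀ s, 1 ≤ s → s ≤ n → g s = g' s) : oprod g n = oprod g' n := by
  induction n with
  | zero => rfl
  | succ n ih =>
    rw [oprod_succ, oprod_succ, ih fun s h₁ h₂ => h s h₁ (by omega),
      h (n + 1) (by omega) le_rfl]

/-- The matrix of a full cycle `x_{-1}(y 1) ⋯ x_{-r}(y r)`. -/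
def cycleMat (r : ℕ) (y : ℕ → ℂ) : Matrix (Fin (2 * r)) (Fin (2 * r)) ℂ :=
  Matrix.of fun k l => stepWeight r y l k

/-- Extension of a finite chain of index tuples to all times and rows. -/
def extendPath {m d N : ℕ} (P : Fin (m + 1) → Fin d → Fin N) (t i : ℕ) : ℕ :=
  if h : i < d then P ⟨min t m, by omega⟩ ⟨i, h⟩ else 0

/-- Extension of a finite array to all layers and rows, by `R` from layer `n` on. -/
def extendTableau {n d N : ℕ} (R : ℕ → ℕ) (F : Fin n → Fin d → Fin N) (s i : ℕ) : ℕ :=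
  if h : i < d then (if hs : s < n then F ⟨s, hs⟩ ⟨i, h⟩ else R i) else 0

theorem extendPath_of_le {m d N t i : ℕ} (P : Fin (m + 1) → Fin d → Fin N) (ht : t ≤ m)
    (hi : i < d) : extendPath P t i = P ⟨t, by omega⟩ ⟨i, hi⟩ := by
  simp [extendPath, hi, min_eq_left ht]

theorem extendPath_of_ge {m d N t i : ℕ} (P : Fin (m + 1) → Fin d → Fin N) (ht : m ≤ t)
    (hi : i < d) : extendPath P t i = P (Fin.last m) ⟨i, hi⟩ := by
  simp [extendPath, hi, min_eq_right ht, Fin.last]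

theorem extendTableau_of_lt {n d N s i : ℕ} (R : ℕ → ℕ) (F : Fin n → Fin d → Fin N)
    (hs : s < n) (hi : i < d) : extendTableau R F s i = F ⟨s, hs⟩ ⟨i, hi⟩ := by
  simp [extendTableau, hi, hs]

theorem extendTableau_of_ge {n d N s i : ℕ} (R : ℕ → ℕ) (F : Fin n → Fin d → Fin N)
    (hs : n ≤ s) (hi : i < d) : extendTableau R F s i = R i := by
  simp [extendTableau, hi, hs]

theorem lt_of_forall_lt_succ {d : ℕ} {f : ℕ → ℕ} (h : ∀ i, i + 1 < d → f i < f (i + 1))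
    {i j : ℕ} (hij : i < j) (hj : j < d) : f i < f j := by
  induction j, hij using Nat.le_induction with
  | base => exact h i hj
  | succ j _ ih => exact (ih (by omega)).trans (h j hj)

theorem PathFamily.congr {r m d : ℕ} {R : ℕ → ℕ} {P P' : ℕ → ℕ → ℕ}
    (hP : PathFamily r m d R P) (h : ∀ t i, i < d → P' t i = P t i) :
    PathFamily r m d R P' where
  start i hi := by rw [h _ _ hi]; exact hP.start i hi
  finish i hi t ht := by rw [h _ _ hi]; exact hP.finish i hi t ht
  mono i hi t := by rw [h _ _ hi, h _ _ hi]; exact hP.mono i hi t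
  step i hi t := by rw [h _ _ hi, h _ _ hi]; exact hP.step i hi t
  strict i hi t := by rw [h _ _ hi, h _ _ (by omega)]; exact hP.strict i hi t
  interlace i hi t := by rw [h _ _ hi, h _ _ (by omega)]; exact hP.interlace i hi t

theorem IsTableau.congr {n d : ℕ} {R : ℕ → ℕ} {F F' : ℕ → ℕ → ℕ}
    (hF : IsTableau n d R F) (h : ∀ s i, i < d → F' s i = F s i) :
    IsTableau n d R F' where
  finish i hi t ht := by rw [h _ _ hi]; exact hF.finish i hi t ht
  mono i hi t := by rw [h _ _ hi, h _ _ hi]; exact hF.mono i hi t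
  strict i hi t := by rw [h _ _ hi, h _ _ (by omega)]; exact hF.strict i hi t

theorem pathToTableau_congr {r d : ℕ} {P P' : ℕ → ℕ → ℕ}
    (h : ∀ t i, i < d → P' t i = P t i) {i : ℕ} (hi : i < d) (s : ℕ) :
    pathToTableau r P' s i = pathToTableau r P s i := by
  simp only [pathToTableau, h _ _ hi]

theorem tableauToPath_congr {r d : ℕ} {F F' : ℕ → ℕ → ℕ}
    (h : ∀ s i, i < d → F' s i = F s i) {i : ℕ} (hi : i < d) (t : ℕ) :
    tableauToPath r F' t i = tableauToPath r F t i := by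
  simp only [tableauToPath, h _ _ hi]

theorem pathToTableau_lt {r : ℕ} (hr : 0 < r) (P : ℕ → ℕ → ℕ) (s i : ℕ) :
    pathToTableau r P s i < 2 * r := by
  have : pathToTableau r P s i ≤ 2 * r - 1 := Nat.findGreatest_le _
  omega

theorem tableauToPath_lt {r : ℕ} (hr : 0 < r) (F : ℕ → ℕ → ℕ) (t i : ℕ) :
    tableauToPath r F t i < 2 * r := by
  have : tableauToPath r F t i ≤ 2 * r - 1 := Nat.findGreatest_le _
  omega

section Minor

variable {r m m' d : ℕ} {Y : ℕ → ℕ → ℂ}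

theorem rowR_of_le {i : ℕ} (h : i + 1 + m' ≤ r) : rowR r m' d i = m' + i := if_pos h

theorem rowR_of_lt {i : ℕ} (h : r < i + 1 + m') : rowR r m' d i = 2 * r + i - d :=
  if_neg (by omega)

theorem rowR_lt {i : ℕ} (hi : i < d) (hdr : d ≤ r) : rowR r m' d i < 2 * r := by
  unfold rowR
  split_ifs <;> omega

theorem rowR_succ_lt {i : ℕ} (hi : i + 1 < d) (hdr : d ≤ r) :
    rowR r m' d i < rowR r m' d (i + 1) := by
  unfold rowR
  split_ifs <;> omega

theorem xL_mulVec_vv (hm : 1 ≤ m) (hdr : d ≤ r) (hY0 : ∀ s, Y s 0 = 1)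
    (hYr1 : ∀ s, Y s (r + 1) = 1)
    (hYne : ∀ s l, 1 ≤ s → s ≤ m → 1 ≤ l → l ≤ r → Y s l ≠ 0) {j : ℕ} (hj : j < d) :
    xL r m d Y *ᵥ vv r j = oprod (fun s => cycleMat r (Y s)) m *ᵥ vv r j := by
  obtain ⟨m, rfl⟩ : ∃ k, m = k + 1 := ⟨m - 1, by omega⟩
  have cycle : ∀ s, 1 ≤ s → s ≤ m + 1 →
      oprod (fun l => xmMat r l (Y s l)) r = cycleMat r (Y s) := by
    intro s h1 h2
    ext k l
    rw [oprod_xmMat_apply (hY0 s) (hYr1 s) fun l => hYne s l h1 h2]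
    rfl
  rw [xL, oprod_succ, oprod_succ, ← mulVec_mulVec, ← mulVec_mulVec, if_pos rfl,
    ← oprod_xmMat_mulVec_stable hj hdr le_rfl, cycle _ (by omega) le_rfl]
  congr 1
  refine oprod_congr fun s h1 h2 => ?_
  rw [if_neg (by omega), cycle s h1 (by omega)]

open Classical in
theorem deltaL_eq_sum_paths (hm : 1 ≤ m) (hdr : d ≤ r) (hY0 : ∀ s, Y s 0 = 1)
    (hYr1 : ∀ s, Y s (r + 1) = 1)
    (hYne : ∀ s l, 1 ≤ s → s ≤ m → 1 ≤ l → l ≤ r → Y s l ≠ 0) :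
    DeltaL r m m' d Y = ∑ P : Fin (m + 1) → Fin d → Fin (2 * r),
      if PathFamily r m d (rowR r m' d) (extendPath P) then
        ∏ i ∈ Finset.range d, ∏ t ∈ Finset.range m,
          stepWeight r (Y (m - t)) (extendPath P t i) (extendPath P (t + 1) i)
      else 0 := by
  set K₀ : Fin d → Fin (2 * r) := fun i => ⟨i, by omega⟩ with hK₀
  set K₁ : Fin d → Fin (2 * r) := fun i => ⟨rowR r m' d i, rowR_lt i.isLt hdr⟩ with hK₁
  have h₀ : StrictMono K₀ := fun i j h => h
  have h₁ : StrictMono K₁ := fun i j h =>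
    lt_of_forall_lt_succ (f := rowR r m' d) (fun i hi => rowR_succ_lt hi hdr) h j.isLt
  have hdet : DeltaL r m m' d Y =
      ((oprod (fun s => cycleMat r (Y s)) m).submatrix K₁ K₀).det := by
    unfold DeltaL
    congr 1
    ext i j
    rw [of_apply, ent, xL_mulVec_vv hm hdr hY0 hYr1 hYne j.isLt]
    exact ent_eq _ (rowR_lt i.isLt hdr) (by omega)
  rw [hdet, det_submatrix_oprod _ _ _ _ h₀ h₁]
  refine Finset.sum_congr rfl fun P _ => ?_
  have hminor : (∀ t, StrictMono (P t)) → ∀ t : Fin m,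
      ((cycleMat r (Y (m - t))).submatrix (P t.succ) (P t.castSucc)).det =
      if ∀ i j, i < j → r ≤ (P t.castSucc i : ℕ) + 1 →
        (P t.succ i : ℕ) < P t.castSucc j then
        ∏ i, stepWeight r (Y (m - t)) (P t.castSucc i) (P t.succ i) else 0 := fun hP t =>
    det_stepWeight r (Y (m - t)) (fun i => (P t.castSucc i : ℕ)) (fun i => (P t.succ i : ℕ))
      (hP _) (hP _)
  have hext : ∀ (t : Fin m) (i : Fin d), extendPath P t i = P t.castSucc i ∧
      extendPath P (t + 1) i = P t.succ i := fun t i =>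
    ⟨extendPath_of_le P t.isLt.le i.isLt, extendPath_of_le P t.isLt i.isLt⟩
  have hprod : ∏ i ∈ Finset.range d, ∏ t ∈ Finset.range m,
      stepWeight r (Y (m - t)) (extendPath P t i) (extendPath P (t + 1) i) =
      ∏ t : Fin m, ∏ i, stepWeight r (Y (m - t)) (P t.castSucc i) (P t.succ i) := by
    rw [Finset.prod_comm, Finset.prod_range]
    refine Finset.prod_congr rfl fun t _ => ?_
    rw [Finset.prod_range]
    refine Finset.prod_congr rfl fun i _ => ?_
    rw [(hext t i).1, (hext t i).2]
  rw [hprod]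
  by_cases hP : PathFamily r m d (rowR r m' d) (extendPath P)
  · have hmono : ∀ t, StrictMono (P t) := by
      intro t i j hij
      have := lt_of_forall_lt_succ (fun i hi => hP.strict i hi t) hij j.isLt
      rwa [extendPath_of_le P (by omega) i.isLt, extendPath_of_le P (by omega) j.isLt] at this
    rw [if_pos hP, if_pos]
    · refine Finset.prod_congr rfl fun t _ => ?_
      rw [hminor hmono t, if_pos]
      intro i j hij hr
      rw [← (hext t i).1] at hr
      rw [← (hext t i).2, ← (hext t j).1]
      have h1 := lt_of_forall_lt_succ (fun i hi => hP.strict i hi t) hij j.isLt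
      have h2 := hP.mono i i.isLt t
      have h3 := lt_of_forall_lt_succ (fun i hi => hP.strict i hi (t + 1)) hij j.isLt
      by_cases h : r ≤ extendPath P (t + 1) i
      · have hi1 : (i : ℕ) + 1 < d := by omega
        refine (hP.interlace i hi1 t h).trans_le ?_
        rcases Nat.lt_or_ge (i + 1) j with h' | h'
        · exact (lt_of_forall_lt_succ (fun i hi => hP.strict i hi t) h' j.isLt).le
        · rw [show (j : ℕ) = i + 1 by omega]
      · omega
    · refine ⟨funext fun i => Fin.ext ?_, funext fun i => Fin.ext ?_, hmono⟩
      · exact (extendPath_of_le P (Nat.zero_le m) i.isLt).symm.trans (hP.start i i.isLt)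
      · exact (extendPath_of_ge P le_rfl i.isLt).symm.trans (hP.finish i i.isLt m le_rfl)
  · rw [if_neg hP]
    split_ifs with hA
    · obtain ⟨hA0, hA1, hmono⟩ := hA
      rw [Finset.prod_congr rfl fun t _ => hminor hmono t]
      by_contra hne
      rw [← ne_eq, Finset.prod_ne_zero_iff] at hne
      have hstep : ∀ t : Fin m, (∀ i j, i < j → r ≤ (P t.castSucc i : ℕ) + 1 →
          (P t.succ i : ℕ) < P t.castSucc j) ∧
          ∀ i, stepWeight r (Y (m - t)) (P t.castSucc i) (P t.succ i) ≠ 0 := by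
        intro t
        have := hne t (Finset.mem_univ t)
        split_ifs at this with h
        · exact ⟨h, fun i => Finset.prod_ne_zero_iff.1 this i (Finset.mem_univ i)⟩
        · exact absurd rfl this
      have hlast : ∀ i (hi : i < d), (P (Fin.last m) ⟨i, hi⟩ : ℕ) = rowR r m' d i := by
        intro i hi
        rw [hA1]
      refine hP ⟨?_, ?_, ?_, ?_, ?_, ?_⟩
      · intro i hi
        rw [extendPath_of_le P (Nat.zero_le m) hi]
        exact congrArg Fin.val (congrFun hA0 ⟨i, hi⟩)
      · intro i hi t ht
        rw [extendPath_of_ge P ht hi, hlast]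
      · intro i hi t
        by_cases ht : t < m
        · rw [(hext ⟨t, ht⟩ ⟨i, hi⟩).1, (hext ⟨t, ht⟩ ⟨i, hi⟩).2]
          by_contra h
          exact (hstep ⟨t, ht⟩).2 ⟨i, hi⟩ (stepWeight_of_lt (by omega))
        · rw [extendPath_of_ge P (by omega) hi, extendPath_of_ge P (by omega) hi]
      · intro i hi t
        by_cases ht : t < m
        · rw [(hext ⟨t, ht⟩ ⟨i, hi⟩).1, (hext ⟨t, ht⟩ ⟨i, hi⟩).2]
          intro hr
          by_contra h
          exact (hstep ⟨t, ht⟩).2 ⟨i, hi⟩ (stepWeight_of_succ_lt hr (by omega))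
        · rw [extendPath_of_ge P (by omega) hi, extendPath_of_ge P (by omega) hi]
          omega
      · intro i hi t
        have hlt := hmono ⟨min t m, by omega⟩ (show (⟨i, by omega⟩ : Fin d) < ⟨i + 1, hi⟩ by
          simp)
        rw [extendPath, extendPath, dif_pos hi, dif_pos (by omega : i < d)]
        exact hlt
      · intro i hi t
        have hi' : i < d := by omega
        by_cases ht : t < m
        · rw [(hext ⟨t, ht⟩ ⟨i, hi'⟩).2, (hext ⟨t, ht⟩ ⟨i + 1, hi⟩).1]
          intro hr
          by_cases h : r ≤ (P (Fin.castSucc ⟨t, ht⟩) ⟨i, hi'⟩ : ℕ) + 1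
          · exact (hstep ⟨t, ht⟩).1 _ _ (by simp) h
          · exact absurd (stepWeight_of_succ_lt (by omega) (by omega))
              ((hstep ⟨t, ht⟩).2 ⟨i, hi'⟩)
        · intro _
          rw [extendPath_of_ge P (by omega) hi', extendPath_of_ge P (by omega) hi, hlast, hlast]
          exact rowR_succ_lt hi hdr
    · rfl

theorem isTableau_extendTableau_iff {n : ℕ} (hdr : d ≤ r) (F : Fin n → Fin d → Fin (2 * r)) :
    IsTableau n d (rowR r m' d) (extendTableau (rowR r m' d) F) ↔
      ((∀ (s : Fin n) (i j : Fin d), i < j → F s i < F s j) ∧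
        (∀ (i : Fin d) (s t : Fin n), s ≤ t → F s i ≤ F t i) ∧
        (∀ (i : Fin d), (i : ℕ) + 1 + m' ≤ r →
          ∀ s : Fin n, (F s i : ℕ) ≤ m' + (i : ℕ))) := by
  have hext : ∀ (s : Fin n) (i : Fin d), extendTableau (rowR r m' d) F s i = F s i :=
    fun s i => extendTableau_of_lt _ F s.isLt i.isLt
  constructor
  · intro hF
    refine ⟨fun s i j hij => ?_, fun i s t hst => ?_, fun i hi s => ?_⟩
    · have := lt_of_forall_lt_succ (fun i hi => hF.strict i hi s) hij j.isLt
      rwa [hext, hext] at this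
    · have : extendTableau (rowR r m' d) F s i ≤ extendTableau (rowR r m' d) F t i :=
        hF.monotone i.isLt hst
      rwa [hext, hext] at this
    · have := hF.le_finish i.isLt s
      rwa [hext, rowR_of_le hi] at this
  · rintro ⟨hs, hm, hb⟩
    have bound : ∀ (s : Fin n) (k i : ℕ) (hi : i + k < d),
        (F s ⟨i, by omega⟩ : ℕ) + k ≤ F s ⟨i + k, hi⟩ := by
      intro s k i hi
      induction k with
      | zero => simp
      | succ k ih =>
        have h1 := ih (by omega)
        have h2 : (F s ⟨i + k, by omega⟩ : ℕ) < F s ⟨i + (k + 1), hi⟩ :=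
          hs s ⟨i + k, by omega⟩ ⟨i + (k + 1), hi⟩ (by simp)
        omega
    refine ⟨fun i hi s hs => extendTableau_of_ge _ _ hs hi, fun i hi s => ?_, fun i hi s => ?_⟩
    · by_cases h1 : s + 1 < n
      · rw [extendTableau_of_lt _ _ h1 hi, extendTableau_of_lt _ _ (by omega) hi]
        exact hm _ _ _ (by simp)
      · rw [extendTableau_of_ge _ _ (by omega : n ≤ s + 1) hi]
        by_cases h2 : s < n
        · rw [extendTableau_of_lt _ _ h2 hi]
          by_cases him : i + 1 + m' ≤ r
          · rw [rowR_of_le him]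
            exact hb ⟨i, hi⟩ him _
          · rw [rowR_of_lt (by omega)]
            have := bound ⟨s, h2⟩ (d - 1 - i) i (by omega)
            have := (F ⟨s, h2⟩ ⟨i + (d - 1 - i), by omega⟩).isLt
            omega
        · rw [extendTableau_of_ge _ _ (by omega) hi]
    · by_cases h : s < n
      · rw [extendTableau_of_lt _ _ h hi, extendTableau_of_lt _ _ h (by omega)]
        exact hs _ _ _ (by simp)
      · rw [extendTableau_of_ge _ _ (by omega) hi, extendTableau_of_ge _ _ (by omega) (by omega)]
        exact rowR_succ_lt hi hdr

end Minor

/- **Statement 0** (Theorem 5.7 of the paper): explicit form of the generalized minor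
`Δ^L(k; 𝐢)(Y)` as a sum, over all families `(k^{(s)}_i)` satisfying `(*)`, of Laurent
monomials in the variables `Y_{s,l}`.  Families are encoded as functions
`F : Fin (m-m') → Fin d → Fin (2*r)` (`F s i` is the 0-indexed natural encoding of
`k^{(s+1)}_{i+1} ∈ J`); the condition `(*)` is the `if`-condition below, and for a family
satisfying `(*)`, `k^{(s)}_i` is unbarred iff `(F s i : ℕ) < r`, in which case its `J`-value
is `F s i + 1` and `l^{(s)}_i = k^{(s)}_i + s - i - 1 = F s i + s₀ - i₀` (`s₀ = s - 1`,
`i₀ = i - 1` the 0-indexed labels); if `k^{(s)}_i` is barred then `|k^{(s)}_i| = 2r - F s i`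
and `l^{(s)}_i = s - i + r = s₀ + r - i₀`. -/
open Classical in
theorem deltaL_eq_sum_monomials
    (r m m' d : ℕ) (hr : 2 ≤ r) (hm'1 : 1 ≤ m') (hm'm : m' ≤ m) (hmr : m ≤ r)
    (hd1 : 1 ≤ d) (hdr : d ≤ r)
    (Y : ℕ → ℕ → ℂ)
    (hY0 : ∀ s, Y s 0 = 1) (hYr1 : ∀ s, Y s (r+1) = 1) (hYm : ∀ l, d < l → Y m l = 1)
    (hYne : ∀ s l, 1 ≤ s → s ≤ m → 1 ≤ l → l ≤ r → Y s l ≠ 0) :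
    DeltaL r m m' d Y =
      ∑ F : Fin (m - m') → Fin d → Fin (2*r),
        if ((∀ (s : Fin (m - m')) (i j : Fin d), i < j → F s i < F s j) ∧
            (∀ (i : Fin d) (s t : Fin (m - m')), s ≤ t → F s i ≤ F t i) ∧
            (∀ (i : Fin d), (i : ℕ) + 1 + m' ≤ r →
              ∀ s : Fin (m - m'), (F s i : ℕ) ≤ m' + (i : ℕ)))
        then ∏ i : Fin d, ∏ s : Fin (m - m'),
          (if (F s i : ℕ) < r
           then Cbar Y (m - ((F s i : ℕ) + (s : ℕ) - (i : ℕ))) ((F s i : ℕ) + 1)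
           else Cc Y (m - ((s : ℕ) + r - (i : ℕ))) (2*r - (F s i : ℕ) - 1))
        else 0 := by
  have hR : ∀ i, i < d → rowR r m' d i < 2 * r := fun i hi => rowR_lt hi hdr
  have hRu : ∀ i, i < d → i + 1 + m' ≤ r → rowR r m' d i = m' + i :=
    fun i _ h => rowR_of_le h
  have hRb : ∀ i, i < d → r < i + 1 + m' → rowR r m' d i = 2 * r + i - d :=
    fun i _ h => rowR_of_lt h
  have hr0 : 0 < r := by omega
  have hm'r : m' ≤ r := hm'm.trans hmr
  have hnm : m - m' + m' = m := Nat.sub_add_cancel hm'm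
  rw [deltaL_eq_sum_paths (by omega) hdr hY0 hYr1 hYne, ← Finset.sum_filter]
  simp_rw [← isTableau_extendTableau_iff (m' := m') hdr]
  rw [← Finset.sum_filter]
  let toF : (Fin (m + 1) → Fin d → Fin (2 * r)) → Fin (m - m') → Fin d → Fin (2 * r) :=
    fun P s i => ⟨pathToTableau r (extendPath P) s i, pathToTableau_lt hr0 _ _ _⟩
  let toP : (Fin (m - m') → Fin d → Fin (2 * r)) → Fin (m + 1) → Fin d → Fin (2 * r) :=
    fun F t i => ⟨tableauToPath r (extendTableau (rowR r m' d) F) t i,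
      tableauToPath_lt hr0 _ _ _⟩
  have tableau : ∀ P : Fin (m + 1) → Fin d → Fin (2 * r),
      PathFamily r m d (rowR r m' d) (extendPath P) →
      IsTableau (m - m') d (rowR r m' d) (pathToTableau r (extendPath P)) := fun P hP =>
    hP.isTableau hR hdr hm'r hnm hRu hRb
  have path : ∀ F : Fin (m - m') → Fin d → Fin (2 * r),
      IsTableau (m - m') d (rowR r m' d) (extendTableau (rowR r m' d) F) →
      PathFamily r m d (rowR r m' d) (tableauToPath r (extendTableau (rowR r m' d) F)) :=
    fun F hF => hF.pathFamily hR hdr hnm hRu hRb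
  have extend_toF : ∀ P : Fin (m + 1) → Fin d → Fin (2 * r),
      PathFamily r m d (rowR r m' d) (extendPath P) → ∀ s i, i < d →
      extendTableau (rowR r m' d) (toF P) s i = pathToTableau r (extendPath P) s i := by
    intro P hP s i hi
    by_cases hs : s < m - m'
    · rw [extendTableau_of_lt _ _ hs hi]
    · rw [extendTableau_of_ge _ _ (by omega) hi, (tableau P hP).finish i hi s (by omega)]
  have extend_toP : ∀ F : Fin (m - m') → Fin d → Fin (2 * r),
      IsTableau (m - m') d (rowR r m' d) (extendTableau (rowR r m' d) F) → ∀ t i, i < d →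
      extendPath (toP F) t i = tableauToPath r (extendTableau (rowR r m' d) F) t i := by
    intro F hF t i hi
    by_cases ht : t ≤ m
    · rw [extendPath_of_le _ ht hi]
    · rw [extendPath_of_ge _ (by omega) hi, (path F hF).finish i hi t (by omega)]
      exact (path F hF).finish i hi m le_rfl
  refine Finset.sum_bij' (fun P _ => toF P) (fun F _ => toP F) ?_ ?_ ?_ ?_ ?_
  · intro P hP
    rw [Finset.mem_filter] at hP ⊢
    exact ⟨Finset.mem_univ _, (tableau P hP.2).congr (extend_toF P hP.2)⟩
  · intro F hF
    rw [Finset.mem_filter] at hF ⊢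
    exact ⟨Finset.mem_univ _, (path F hF.2).congr (extend_toP F hF.2)⟩
  · intro P hP
    rw [Finset.mem_filter] at hP
    funext t i
    apply Fin.ext
    change tableauToPath r (extendTableau (rowR r m' d) (toF P)) t i = P t i
    rw [tableauToPath_congr (extend_toF P hP.2) i.isLt,
      tableauToPath_pathToTableau hP.2 (tableau P hP.2) hR i.isLt]
    exact extendPath_of_le P (by omega) i.isLt
  · intro F hF
    rw [Finset.mem_filter] at hF
    funext s i
    apply Fin.ext
    change pathToTableau r (extendPath (toP F)) s i = F s i
    rw [pathToTableau_congr (extend_toP F hF.2) i.isLt,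
      pathToTableau_tableauToPath hF.2 (path F hF.2) hR hdr i.isLt]
    exact extendTableau_of_lt _ F s.isLt i.isLt
  · intro P hP
    rw [Finset.mem_filter] at hP
    rw [prod_stepWeight_eq_prod_pauseWeight hP.2 (tableau P hP.2)
      (fun i hi => hP.2.le_pathToTableau hR hi) hR hdr hm'r hnm hm'1 hRu hRb hY0 hYr1 hYne,
      Finset.prod_range]
    refine Finset.prod_congr rfl fun i _ => ?_
    rw [Finset.prod_range]
    refine Finset.prod_congr rfl fun s _ => ?_
    change pauseWeight r m Y (min (toF P s i : ℕ) r + s - i) (toF P s i : ℕ) = _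
    unfold pauseWeight
    split_ifs with h
    · rw [min_eq_left h.le]
    · rw [min_eq_right (by omega), add_comm r]

end CTypeMinors
end
end

section
/- Suppose in addition that i_1 < i_2 < ⋯ < i_d in the order of J (so that i_1,…,i_δ are unbarred, i_{δ+1},…,i_d are barred, and |i_{δ+1}| > |i_{δ+2}| > ⋯ > |i_d|). Then the expansion of Λ^d(X)(v_{i_1} ∧ ⋯ ∧ v_{i_d}) may be restricted to V′ ⊆ V: (a) if δ = 0 or i_δ < r, then Λ^d(X)(v_{i_1} ∧ ⋯ ∧ v_{i_d}) = Σ_{(j_1,…,j_d) ∈ V′} ( ∏_{ζ=1}^{δ} Y_{j_ζ −1}/Y_{i_ζ} )·( ∏_{ζ=δ+1}^{d} Y_{|i_ζ|}/Y_{|j_ζ|−1} )·v_{j_1} ∧ ⋯ ∧ v_{j_d} with V′ := {(j) ∈ V : |j_ζ| > |i_{ζ+1}| for all δ+1 ≤ ζ ≤ d−1}; (b) if i_δ = r, then Λ^d(X)(v_{i_1} ∧ ⋯ ∧ v_{i_d}) = Σ_{(j_1,…,j_d) ∈ V′} ( ∏_{ζ=1}^{δ−1} Y_{j_ζ −1}/Y_{i_ζ}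 )·Y(j_δ)·( ∏_{ζ=δ+1}^{d} Y_{|i_ζ|}/Y_{|j_ζ|−1} )·v_{j_1} ∧ ⋯ ∧ v_{j_d}, with V′ := {(j) ∈ V : |j_ζ| > |i_{ζ+1}| for all δ+1 ≤ ζ ≤ d−1, and additionally |j_δ| > |i_{δ+1}| whenever j_δ is barred}. Here V and Y(j_δ) are as follows: in case (a), V = {(j_1,…,j_d) : j_ζ ∈ {i_ζ, i_ζ+1} for 1 ≤ ζ ≤ δ, j_1 < ⋯ < j_δ, and j_ζ barred with |j_ζ| ≤ |i_ζ| for δ+1 ≤ ζ ≤ d}; in case (b), V = {(j_1,…,j_d) : j_ζ ∈ {i_ζ, i_ζ+1} for 1 ≤ ζ ≤ δ−1, j_1 < ⋯ < j_δ, j_δ ∈ {r, r̄, (r−1)‾, …, 1̄}, and j_ζ barred with |j_ζ| ≤ |i_ζ| for δ+1 ≤ ζ ≤ d}, and Y(j_δ) := Y_{r−1}/Y_r if j_δ = r, Y(j_δ) := 1/Y_{|j_δ|−1} if j_δ is barred. -/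
noncomputable section
open Matrix BigOperators

namespace CTypeMinors

/-- Replacing entries `w i` by `w i - c • w j` with `i < j` does not change the value of an
alternating map. -/
theorem _root_.AlternatingMap.map_eq_of_sub_smul {R M N : Type*} [CommRing R] [AddCommGroup M]
    [Module R M] [AddCommGroup N] [Module R N] {d : ℕ} (g : M [⋀^Fin d]→ₗ[R] N)
    {w w' : Fin d → M}
    (h : ∀ i, w' i = w i ∨ ∃ j, i < j ∧ ∃ c : R, w' i = w i - c • w j) :
    g w = g w' := by
  have key : ∀ k : ℕ, k ≤ d → g w = g (fun i => if (i : ℕ) < k then w' i else w i) := by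
    intro k
    induction k with
    | zero => simp
    | succ k ih =>
      intro hk
      rw [ih (by omega)]
      set u : Fin d → M := fun i => if (i : ℕ) < k then w' i else w i with hu
      have hupd : (fun i : Fin d => if (i : ℕ) < k + 1 then w' i else w i)
          = Function.update u ⟨k, hk⟩ (w' ⟨k, hk⟩) := by
        funext i
        by_cases hi : i = ⟨k, hk⟩
        · subst hi; simp
        · have hne : (i : ℕ) ≠ k := fun e => hi (Fin.ext e)
          rw [Function.update_of_ne hi]
          have : ((i : ℕ) < k + 1) ↔ (i : ℕ) < k := by omega
          simp [hu, this]
      have huk : u ⟨k, hk⟩ = w ⟨k, hk⟩ := by simp [hu]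
      rw [hupd]
      rcases h ⟨k, hk⟩ with h0 | ⟨j, hj, c, hc⟩
      · rw [h0, ← huk, Function.update_eq_self]
      · have huj : u j = w j := by
          have : ¬ (j : ℕ) < k := by have := Fin.lt_def.1 hj; simp at this; omega
          simp [hu, this]
        rw [hc, AlternatingMap.map_update_sub, AlternatingMap.map_update_smul, ← huk, ← huj,
          Function.update_eq_self, AlternatingMap.map_update_self g u hj.ne, smul_zero, sub_zero]
  rw [key d le_rfl]
  simp

/-- A version of `if_congr` in which the decidability instances are found by unification. -/
theorem ite_congr_of_iff {N : Type*} [Zero N] {P Q : Prop} {_ : Decidable P} {_ : Decidable Q}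
    {x y : N} (h : P ↔ Q) (hxy : x = y) : (if P then x else 0) = if Q then y else 0 :=
  if_congr h hxy rfl

theorem ite_eq_ite_of_imp {N : Type*} [Zero N] {P Q : Prop} {_ : Decidable P} {_ : Decidable Q} {x : N}
    (h : Q → P) (hx : P → ¬ Q → x = 0) : (if P then x else 0) = if Q then x else 0 := by
  split_ifs with hP hQ hQ
  · rfl
  · exact hx hP hQ
  · exact absurd (h hQ) hP
  · rfl

theorem eq_sum_smul_vv {r : ℕ} (x : Fin (2 * r) → ℂ) : x = ∑ b, x b • vv r b := by
  funext k
  simp [vv, Finset.sum_apply, ← Fin.ext_iff]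

open Classical in
/-- Expansion of an alternating map on vectors given by their coordinates, where the coordinates
are supported on prescribed sets. -/
theorem map_expand {r d : ℕ} {N : Type*} [AddCommGroup N] [Module ℂ N]
    (g : (Fin (2 * r) → ℂ) [⋀^Fin d]→ₗ[ℂ] N) (cond : Fin d → ℕ → Prop) (val : Fin d → ℕ → ℂ) :
    g (fun ζ k => if cond ζ k then val ζ k else 0) =
      ∑ Jf : Fin d → Fin (2 * r),
        if ∀ ζ, cond ζ (Jf ζ) then (∏ ζ, val ζ (Jf ζ)) • g (fun ζ => vv r (Jf ζ)) else 0 := by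
  have h : (fun (ζ : Fin d) (k : Fin (2 * r)) => if cond ζ k then val ζ k else 0) =
      fun ζ => ∑ b : Fin (2 * r), (if cond ζ b then val ζ b else 0) • vv r b := by
    funext ζ
    exact eq_sum_smul_vv _
  rw [h]
  refine (g.toMultilinearMap.map_sum _).trans (Finset.sum_congr rfl fun Jf _ => ?_)
  refine (g.toMultilinearMap.map_smul_univ _ _).trans ?_
  split_ifs with hJ
  · simp [hJ]
  · obtain ⟨ζ, hζ⟩ := not_forall.1 hJ
    rw [Finset.prod_eq_zero (Finset.mem_univ ζ) (by simp [hζ]), zero_smul]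

theorem map_vv_eq_zero {r d : ℕ} {N : Type*} [AddCommGroup N] [Module ℂ N]
    (g : (Fin (2 * r) → ℂ) [⋀^Fin d]→ₗ[ℂ] N) {Jf : Fin d → Fin (2 * r)} {ζ η : Fin d}
    (hne : ζ ≠ η) (h : (Jf ζ : ℕ) = Jf η) : g (fun ζ => vv r (Jf ζ)) = 0 :=
  g.map_eq_zero_of_eq _ (by simp only [h]) hne

theorem xmMat_mulVec_vv {r i a : ℕ} (t : ℂ) (ha : a < 2 * r) :
    xmMat r i t *ᵥ vv r a =
      (if a + 1 = i ∨ a + i + 1 = 2 * r then t⁻¹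
        else if a = i ∨ a + i = 2 * r then t else 1) •
      (vv r a + if a + 1 = i ∨ a + i + 1 = 2 * r then t • vv r (a + 1) else 0) := by
  funext k
  rw [vv_eq_single ha, Matrix.mulVec_single_one, ← vv_eq_single ha]
  simp only [xmMat, alMat, yMat, fMat, Matrix.col_apply, Matrix.mul_diagonal, inv_inv,
    Matrix.add_apply, Matrix.smul_apply, Matrix.of_apply, Matrix.one_apply, Fin.ext_iff,
    Pi.smul_apply, Pi.add_apply, vv, smul_eq_mul]
  rw [mul_comm]
  congr 2
  by_cases h : a + 1 = i ∨ a + i + 1 = 2 * r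
  · rw [if_pos h]
    simp only [Pi.smul_apply, smul_eq_mul]
    congr 1
    apply if_congr _ rfl rfl
    omega
  · rw [if_neg h, if_neg (by omega)]
    simp

section Columns

variable {r : ℕ} {Y : ℕ → ℂ}

theorem oprod_zero {N : ℕ} (g : ℕ → Matrix (Fin N) (Fin N) ℂ) : oprod g 0 = 1 := by
  simp [oprod]

theorem oprod_succ_mulVec {N : ℕ} (g : ℕ → Matrix (Fin N) (Fin N) ℂ) (n : ℕ) (x : Fin N → ℂ) :
    oprod g (n + 1) *ᵥ x = oprod g n *ᵥ (g (n + 1) *ᵥ x) := by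
  simp [oprod, List.range_succ, Matrix.mulVec_mulVec]

/-- Trailing factors that fix `v_a` can be dropped from the product. -/
theorem oprod_mulVec_vv_of_le {m n a : ℕ} (hmn : m ≤ n) (ha : a < 2 * r)
    (h : ∀ i, m < i → i ≤ n → a + 1 ≠ i ∧ a + i + 1 ≠ 2 * r ∧ a ≠ i ∧ a + i ≠ 2 * r) :
    oprod (fun l => xmMat r l (Y l)) n *ᵥ vv r a =
      oprod (fun l => xmMat r l (Y l)) m *ᵥ vv r a := by
  induction n, hmn using Nat.le_induction with
  | base => rfl
  | succ n hmn ih =>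
    obtain ⟨h1, h2, h3, h4⟩ := h (n + 1) (by omega) le_rfl
    rw [oprod_succ_mulVec, xmMat_mulVec_vv _ ha, if_neg (by omega), if_neg (by omega),
      if_neg (by omega), add_zero, one_smul]
    exact ih fun i hi hin => h i hi (by omega)

theorem oprod_mulVec_vv_fixed {n a : ℕ} (h1 : n < a) (h2 : a + n + 1 < 2 * r) :
    oprod (fun l => xmMat r l (Y l)) n *ᵥ vv r a = vv r a := by
  rw [oprod_mulVec_vv_of_le (Nat.zero_le n) (by omega) (fun i _ _ => by omega), oprod_zero,
    Matrix.one_mulVec]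

theorem oprod_mulVec_vv_self {n : ℕ} (hY0 : Y 0 = 1) (hn : n < r) :
    oprod (fun l => xmMat r l (Y l)) n *ᵥ vv r n = Y n • vv r n := by
  cases n with
  | zero => simp [oprod_zero, hY0]
  | succ n =>
    rw [oprod_succ_mulVec, xmMat_mulVec_vv _ (by omega), if_neg (by omega), if_pos (by omega),
      if_neg (by omega), add_zero, Matrix.mulVec_smul,
      oprod_mulVec_vv_fixed (by omega) (by omega)]

theorem oprod_mulVec_vv_bar {n : ℕ} (hY0 : Y 0 = 1) (hYne : ∀ l, 1 ≤ l → l ≤ r → Y l ≠ 0)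
    (hn : n < r) :
    oprod (fun l => xmMat r l (Y l)) n *ᵥ vv r (2 * r - n - 1) =
      fun k : Fin (2 * r) => if 2 * r ≤ (k : ℕ) + n + 1 then (Y (2 * r - k - 1))⁻¹ else 0 := by
  induction n with
  | zero =>
    rw [oprod_zero, Matrix.one_mulVec]
    funext k
    have hk := k.2
    by_cases h : (k : ℕ) = 2 * r - 1
    · rw [if_pos (by omega), show 2 * r - (k : ℕ) - 1 = 0 by omega, hY0]
      simp [vv, h]
    · rw [if_neg (by omega)]
      simp [vv, h]
  | succ n ih =>
    have hY : Y (n + 1) ≠ 0 := hYne _ (by omega) (by omega)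
    rw [oprod_succ_mulVec, xmMat_mulVec_vv _ (by omega), if_pos (by omega), if_pos (by omega),
      smul_add, smul_smul, inv_mul_cancel₀ hY, one_smul, Matrix.mulVec_add, Matrix.mulVec_smul,
      oprod_mulVec_vv_fixed (by omega) (by omega),
      show 2 * r - (n + 1) - 1 + 1 = 2 * r - n - 1 by omega, ih (by omega)]
    funext k
    have hk := k.2
    simp only [Pi.add_apply, Pi.smul_apply, vv, smul_eq_mul]
    by_cases h : (k : ℕ) = 2 * r - (n + 1) - 1
    · rw [if_pos h, if_neg (by omega), if_pos (by omega),
        show 2 * r - (k : ℕ) - 1 = n + 1 by omega]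
      simp
    · rw [if_neg h, mul_zero, zero_add]
      exact if_congr (by omega) rfl rfl

/-- The columns of `X` indexed by the barred elements. -/
theorem mulVec_vv_barred (hY0 : Y 0 = 1) (hYne : ∀ l, 1 ≤ l → l ≤ r → Y l ≠ 0)
    {a : ℕ} (ha : r ≤ a) (ha' : a < 2 * r) :
    oprod (fun l => xmMat r l (Y l)) r *ᵥ vv r a =
      fun k : Fin (2 * r) => if a ≤ (k : ℕ) then Y (2 * r - a) / Y (2 * r - k - 1) else 0 := by
  obtain ⟨n, hn⟩ : ∃ n, 2 * r - a = n + 1 := ⟨2 * r - a - 1, by omega⟩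
  have key : oprod (fun l => xmMat r l (Y l)) r *ᵥ vv r a =
      oprod (fun l => xmMat r l (Y l)) (n + 1) *ᵥ vv r a := by
    rcases eq_or_lt_of_le ha with h | h
    · rw [show r = n + 1 by omega]
    · exact oprod_mulVec_vv_of_le (by omega) ha' fun i _ _ => by omega
  have hb := oprod_mulVec_vv_bar hY0 hYne (show n < r by omega)
  rw [show 2 * r - n - 1 = a by omega] at hb
  rw [key, oprod_succ_mulVec, xmMat_mulVec_vv _ ha', if_neg (by omega), if_pos (by omega),
    if_neg (by omega), add_zero, Matrix.mulVec_smul, hb, hn]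
  funext k
  simp only [Pi.smul_apply, smul_eq_mul, mul_ite, mul_zero, ← div_eq_mul_inv]
  exact if_congr (by omega) rfl rfl

/-- The column of `X` indexed by the largest unbarred element. -/
theorem mulVec_vv_last (hr : 2 ≤ r) (hY0 : Y 0 = 1) (hYne : ∀ l, 1 ≤ l → l ≤ r → Y l ≠ 0) :
    oprod (fun l => xmMat r l (Y l)) r *ᵥ vv r (r - 1) =
      fun k : Fin (2 * r) => if r - 1 ≤ (k : ℕ) then
        (if (k : ℕ) = r - 1 then Y (r - 1) / Y r else 1 / Y (2 * r - k - 1)) else 0 := by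
  obtain ⟨n, rfl⟩ : ∃ n, r = n + 1 := ⟨r - 1, by omega⟩
  have hY : Y (n + 1) ≠ 0 := hYne _ (by omega) le_rfl
  have hb := oprod_mulVec_vv_bar hY0 hYne (show n < n + 1 by omega)
  rw [show 2 * (n + 1) - n - 1 = n + 1 by omega] at hb
  rw [Nat.add_sub_cancel, oprod_succ_mulVec, xmMat_mulVec_vv _ (by omega), if_pos (by omega),
    if_pos (by omega), smul_add, smul_smul, inv_mul_cancel₀ hY, one_smul, Matrix.mulVec_add,
    Matrix.mulVec_smul, hb, oprod_mulVec_vv_self hY0 (by omega)]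
  funext k
  simp only [Pi.add_apply, Pi.smul_apply, vv, smul_eq_mul]
  by_cases h : (k : ℕ) = n
  · rw [if_pos h, if_neg (by omega), if_pos (by omega), if_pos h]
    ring
  · rw [if_neg h, if_neg h, mul_zero, mul_zero, zero_add, one_div]
    exact if_congr (by omega) rfl rfl

/-- The columns of `X` indexed by the unbarred elements other than the largest one. -/
theorem mulVec_vv_unbarred (hY0 : Y 0 = 1) (hYne : ∀ l, 1 ≤ l → l ≤ r → Y l ≠ 0)
    {a : ℕ} (ha : a + 1 < r) :
    oprod (fun l => xmMat r l (Y l)) r *ᵥ vv r a =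
      fun k : Fin (2 * r) => if (k : ℕ) = a ∨ (k : ℕ) = a + 1 then Y k / Y (a + 1) else 0 := by
  have hY : Y (a + 1) ≠ 0 := hYne _ (by omega) (by omega)
  rw [oprod_mulVec_vv_of_le (m := a + 1) (by omega) (by omega) (fun i _ _ => by omega),
    oprod_succ_mulVec, xmMat_mulVec_vv _ (by omega), if_pos (by omega), if_pos (by omega),
    smul_add, smul_smul, inv_mul_cancel₀ hY, one_smul, Matrix.mulVec_add, Matrix.mulVec_smul,
    oprod_mulVec_vv_self hY0 (by omega), oprod_mulVec_vv_fixed (by omega) (by omega)]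
  funext k
  simp only [Pi.add_apply, Pi.smul_apply, vv, smul_eq_mul]
  by_cases h : (k : ℕ) = a
  · rw [if_pos h, if_neg (by omega), if_pos (by omega), h]
    ring
  · by_cases h' : (k : ℕ) = a + 1
    · rw [if_neg h, if_pos h', if_pos (by omega), h', div_self hY]
      ring
    · rw [if_neg h, if_neg h', if_neg (by omega)]
      ring

/-- Subtracting a multiple of a barred column with larger index `b` truncates a column whose
coordinates from `b` on are proportional to those of the barred column. -/
theorem sub_smul_mulVec_vv (hY0 : Y 0 = 1) (hYne : ∀ l, 1 ≤ l → l ≤ r → Y l ≠ 0)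
    {b : ℕ} (hb : r ≤ b) (hb' : b < 2 * r) (c : ℂ) (x : Fin (2 * r) → ℂ)
    (hx : ∀ k : Fin (2 * r), b ≤ k → x k = c / Y (2 * r - k - 1)) :
    (fun k : Fin (2 * r) => if (k : ℕ) < b then x k else 0) =
      x - (c / Y (2 * r - b)) • (oprod (fun l => xmMat r l (Y l)) r *ᵥ vv r b) := by
  have hY : Y (2 * r - b) ≠ 0 := hYne _ (by omega) (by omega)
  rw [mulVec_vv_barred hY0 hYne hb hb']
  funext k
  simp only [Pi.sub_apply, Pi.smul_apply, smul_eq_mul]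
  by_cases h : (k : ℕ) < b
  · rw [if_pos h, if_neg (by omega), mul_zero, sub_zero]
  · rw [if_neg h, if_pos (by omega), hx k (by omega), div_mul_div_cancel₀ hY, sub_self]

end Columns

open Classical in
/-- Expansion of the wedge of the columns `I ζ` of `X`, given the coordinates `val` of these
columns, when the columns in a set `S` of positions are truncated at the next index. -/
theorem map_wedge_expand {r d : ℕ} {Y : ℕ → ℂ} (hY0 : Y 0 = 1)
    (hYne : ∀ l, 1 ≤ l → l ≤ r → Y l ≠ 0) (I : Fin d → ℕ) (S : Fin d → Prop)
    (hI : ∀ ζ η : Fin d, S ζ → (ζ : ℕ) + 1 = η → r ≤ I η ∧ I η < 2 * r)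
    (cond : Fin d → ℕ → Prop) (val : Fin d → ℕ → ℂ) (c : Fin d → ℂ)
    (hcol : ∀ ζ, oprod (fun l => xmMat r l (Y l)) r *ᵥ vv r (I ζ) =
      fun k : Fin (2 * r) => if cond ζ k then val ζ k else 0)
    (htail : ∀ ζ η : Fin d, S ζ → (ζ : ℕ) + 1 = η → ∀ k, I η ≤ k → k < 2 * r →
      cond ζ k ∧ val ζ k = c ζ / Y (2 * r - k - 1)) :
    (ExteriorAlgebra.map (Matrix.toLin' (oprod (fun l => xmMat r l (Y l)) r)))
        (ExteriorAlgebra.ιMulti ℂ d (fun ζ : Fin d => vv r (I ζ))) =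
      ∑ Jf : Fin d → Fin (2 * r),
        if ∀ ζ, cond ζ (Jf ζ) ∧ (S ζ → ∀ η : Fin d, (ζ : ℕ) + 1 = η → (Jf ζ : ℕ) < I η) then
          (∏ ζ, val ζ (Jf ζ)) • ExteriorAlgebra.ιMulti ℂ d (fun ζ => vv r (Jf ζ)) else 0 := by
  rw [ExteriorAlgebra.map_apply_ιMulti]
  refine Eq.trans ?_ ((map_expand (ExteriorAlgebra.ιMulti ℂ d)
    (fun ζ k => cond ζ k ∧ (S ζ → ∀ η : Fin d, (ζ : ℕ) + 1 = η → k < I η)) val).trans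
    (Finset.sum_congr rfl fun _ _ => ite_congr_of_iff Iff.rfl rfl))
  apply AlternatingMap.map_eq_of_sub_smul
  intro ζ
  simp only [Function.comp_apply, Matrix.toLin'_apply]
  by_cases h : S ζ ∧ ∃ η : Fin d, (ζ : ℕ) + 1 = η
  · obtain ⟨hS, η, hη⟩ := h
    obtain ⟨hb, hb'⟩ := hI ζ η hS hη
    refine Or.inr ⟨η, Fin.lt_def.2 (by omega), c ζ / Y (2 * r - I η), ?_⟩
    rw [hcol ζ, ← sub_smul_mulVec_vv hY0 hYne hb hb' (c ζ)]
    · funext k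
      rw [← ite_and]
      refine ite_congr_of_iff ?_ rfl
      constructor
      · exact fun ⟨h1, h2⟩ => ⟨h2 hS η hη, h1⟩
      · refine fun ⟨h1, h2⟩ => ⟨h2, fun _ η' hη' => ?_⟩
        rwa [show η' = η from Fin.ext (by omega)]
    · intro k hk
      obtain ⟨h1, h2⟩ := htail ζ η hS hη k hk k.2
      simp only [if_pos h1, h2]
  · left
    rw [hcol ζ]
    funext k
    refine ite_congr_of_iff ?_ rfl
    exact and_iff_left fun hS η hη => absurd ⟨hS, η, hη⟩ h

/- **Statement 9** (Lemma 6.10 (iii)): when `i_1 < ⋯ < i_d` in the order of `J`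
(nat encoding: `I` strictly increasing, first `δ` values `< r`, the rest in `[r, 2r)`),
the expansion of `Λ^d(X)(v_{i_1} ∧ ⋯ ∧ v_{i_d})` may be restricted from `V` to `V'`:
(a) if `δ = 0` or `i_δ < r` (the hypothesis `∀ ζ, ζ+1 = δ → I ζ + 1 < r`, vacuous
when `δ = 0`); (b) if `i_δ = r` (the hypothesis `I ζ = r - 1` for `ζ + 1 = δ`). -/
open Classical in
theorem lambda_on_wedge_expansion_reduced
    (r : ℕ) (hr : 2 ≤ r) (Y : ℕ → ℂ) (hY0 : Y 0 = 1)
    (hYne : ∀ l, 1 ≤ l → l ≤ r → Y l ≠ 0)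
    (d : ℕ) (hd1 : 1 ≤ d) (δ : ℕ) (hδ : δ ≤ d) (I : Fin d → ℕ)
    (hIu : ∀ ζ : Fin d, (ζ : ℕ) < δ → I ζ < r)
    (hIb : ∀ ζ : Fin d, δ ≤ (ζ : ℕ) → r ≤ I ζ ∧ I ζ < 2*r)
    (hIinc : ∀ ζ η : Fin d, ζ < η → I ζ < I η) :
    -- (a) `δ = 0` or `i_δ < r`
    ((∀ ζ : Fin d, (ζ : ℕ) + 1 = δ → I ζ + 1 < r) →
      (ExteriorAlgebra.map (Matrix.toLin' (oprod (fun l => xmMat r l (Y l)) r)))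
        (ExteriorAlgebra.ιMulti ℂ d (fun ζ : Fin d => vv r (I ζ))) =
      ∑ Jf : Fin d → Fin (2*r),
        if ((∀ ζ : Fin d, (ζ : ℕ) < δ → ((Jf ζ : ℕ) = I ζ ∨ (Jf ζ : ℕ) = I ζ + 1)) ∧
            (∀ ζ η : Fin d, (η : ℕ) < δ → ζ < η → Jf ζ < Jf η) ∧
            (∀ ζ : Fin d, δ ≤ (ζ : ℕ) → r ≤ (Jf ζ : ℕ) ∧ 2*r - (Jf ζ : ℕ) ≤ 2*r - I ζ) ∧
            (∀ ζ η : Fin d, δ ≤ (ζ : ℕ) → (ζ : ℕ) + 1 = (η : ℕ) →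
               2*r - I η < 2*r - (Jf ζ : ℕ)))
        then (∏ ζ : Fin d,
                if (ζ : ℕ) < δ then Y (Jf ζ : ℕ) / Y (I ζ + 1)
                else Y (2*r - I ζ) / Y (2*r - (Jf ζ : ℕ) - 1)) •
              ExteriorAlgebra.ιMulti ℂ d (fun ζ : Fin d => vv r (Jf ζ : ℕ))
        else 0) ∧
    -- (b) `i_δ = r`
    (1 ≤ δ →
     (∀ ζ : Fin d, (ζ : ℕ) + 1 = δ → I ζ = r - 1) →
      (ExteriorAlgebra.map (Matrix.toLin' (oprod (fun l => xmMat r l (Y l)) r)))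
        (ExteriorAlgebra.ιMulti ℂ d (fun ζ : Fin d => vv r (I ζ))) =
      ∑ Jf : Fin d → Fin (2*r),
        if ((∀ ζ : Fin d, (ζ : ℕ) + 1 < δ → ((Jf ζ : ℕ) = I ζ ∨ (Jf ζ : ℕ) = I ζ + 1)) ∧
            (∀ ζ η : Fin d, (η : ℕ) < δ → ζ < η → Jf ζ < Jf η) ∧
            (∀ ζ : Fin d, (ζ : ℕ) + 1 = δ → r - 1 ≤ (Jf ζ : ℕ)) ∧
            (∀ ζ : Fin d, δ ≤ (ζ : ℕ) → r ≤ (Jf ζ : ℕ) ∧ 2*r - (Jf ζ : ℕ) ≤ 2*r - I ζ) ∧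
            (∀ ζ η : Fin d, δ ≤ (ζ : ℕ) → (ζ : ℕ) + 1 = (η : ℕ) →
               2*r - I η < 2*r - (Jf ζ : ℕ)) ∧
            (∀ ζ η : Fin d, (ζ : ℕ) + 1 = δ → (η : ℕ) = δ → r ≤ (Jf ζ : ℕ) →
               2*r - I η < 2*r - (Jf ζ : ℕ)))
        then (∏ ζ : Fin d,
                if (ζ : ℕ) + 1 < δ then Y (Jf ζ : ℕ) / Y (I ζ + 1)
                else if (ζ : ℕ) + 1 = δ then
                  (if (Jf ζ : ℕ) = r - 1 then Y (r - 1) / Y r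
                   else 1 / Y (2*r - (Jf ζ : ℕ) - 1))
                else Y (2*r - I ζ) / Y (2*r - (Jf ζ : ℕ) - 1)) •
              ExteriorAlgebra.ιMulti ℂ d (fun ζ : Fin d => vv r (Jf ζ : ℕ))
        else 0) := by
  constructor
  · intro hlast
    have hlt : ∀ ζ : Fin d, (ζ : ℕ) < δ → I ζ + 1 < r := by
      intro ζ hζ
      have h1 := hlast ⟨δ - 1, by omega⟩ (by simp; omega)
      rcases Nat.lt_or_ge ζ (δ - 1) with h | h
      · have := hIinc ζ ⟨δ - 1, by omega⟩ (Fin.lt_def.2 h)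
        omega
      · rwa [show ζ = ⟨δ - 1, by omega⟩ from Fin.ext (by simp; omega)]
    refine (map_wedge_expand hY0 hYne I (fun ζ => δ ≤ (ζ : ℕ))
      (fun ζ η h1 h2 => hIb η (by omega))
      (fun ζ k => if (ζ : ℕ) < δ then k = I ζ ∨ k = I ζ + 1 else I ζ ≤ k)
      (fun ζ k => if (ζ : ℕ) < δ then Y k / Y (I ζ + 1)
        else Y (2 * r - I ζ) / Y (2 * r - k - 1))
      (fun ζ => Y (2 * r - I ζ)) ?_ ?_).trans (Finset.sum_congr rfl fun Jf _ => ?_)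
    · intro ζ
      by_cases h : (ζ : ℕ) < δ
      · rw [mulVec_vv_unbarred hY0 hYne (hlt ζ h)]
        funext k
        exact ite_congr_of_iff (by simp only [if_pos h]) (by simp only [if_pos h])
      · have hb := hIb ζ (by omega)
        rw [mulVec_vv_barred hY0 hYne hb.1 hb.2]
        funext k
        exact ite_congr_of_iff (by simp only [if_neg h]) (by simp only [if_neg h])
    · intro ζ η h1 h2 k hk _
      have := hIinc ζ η (Fin.lt_def.2 (by omega))
      simp only [if_neg (not_lt.2 h1), and_true]
      omega
    · refine ite_eq_ite_of_imp ?_ ?_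
      · rintro ⟨h1, -, h3, h4⟩ ζ
        refine ⟨?_, fun hζ η hη => ?_⟩
        · split_ifs with h
          · exact h1 ζ h
          · have := h3 ζ (by omega)
            have := hIb ζ (by omega)
            omega
        · have := h4 ζ η hζ hη
          omega
      · intro hall hP
        have hu : ∀ ζ : Fin d, (ζ : ℕ) < δ → ((Jf ζ : ℕ) = I ζ ∨ (Jf ζ : ℕ) = I ζ + 1) :=
          fun ζ h => by simpa [h] using (hall ζ).1
        have hb : ∀ ζ : Fin d, δ ≤ (ζ : ℕ) → I ζ ≤ Jf ζ :=
          fun ζ h => by simpa [not_lt.2 h] using (hall ζ).1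
        obtain ⟨ζ, η, hη, hlt', hJ⟩ : ∃ ζ η : Fin d, (η : ℕ) < δ ∧ ζ < η ∧ Jf η ≤ Jf ζ := by
          by_contra! hcon
          refine hP ⟨hu, hcon, fun ζ h => ?_, fun ζ η h1 h2 => ?_⟩
          · have := hb ζ h
            have := hIb ζ h
            omega
          · have := (hall ζ).2 h1 η h2
            have := hIb η (by omega)
            omega
        have h0 := Fin.lt_def.1 hlt'
        have h1 := hu ζ (by omega)
        have h2 := hu η hη
        have h3 := hIinc ζ η hlt'
        have h4 := Fin.le_def.1 hJ
        rw [map_vv_eq_zero _ hlt'.ne (by omega), smul_zero]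
  · intro hδ1 hlast
    have hlt : ∀ ζ : Fin d, (ζ : ℕ) + 1 < δ → I ζ + 1 < r := by
      intro ζ hζ
      have h1 := hlast ⟨δ - 1, by omega⟩ (by simp; omega)
      have := hIinc ζ ⟨δ - 1, by omega⟩ (Fin.lt_def.2 (by simp; omega))
      omega
    refine (map_wedge_expand hY0 hYne I (fun ζ => δ ≤ (ζ : ℕ) + 1)
      (fun ζ η h1 h2 => hIb η (by omega))
      (fun ζ k => if (ζ : ℕ) + 1 < δ then k = I ζ ∨ k = I ζ + 1 else I ζ ≤ k)
      (fun ζ k => if (ζ : ℕ) + 1 < δ then Y k / Y (I ζ + 1)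
        else if (ζ : ℕ) + 1 = δ then
          (if k = r - 1 then Y (r - 1) / Y r else 1 / Y (2 * r - k - 1))
        else Y (2 * r - I ζ) / Y (2 * r - k - 1))
      (fun ζ => if (ζ : ℕ) + 1 = δ then 1 else Y (2 * r - I ζ)) ?_ ?_).trans
      (Finset.sum_congr rfl fun Jf _ => ?_)
    · intro ζ
      by_cases h : (ζ : ℕ) + 1 < δ
      · rw [mulVec_vv_unbarred hY0 hYne (hlt ζ h)]
        funext k
        exact ite_congr_of_iff (by simp only [if_pos h]) (by simp only [if_pos h])
      · by_cases h' : (ζ : ℕ) + 1 = δ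
        · rw [hlast ζ h', mulVec_vv_last hr hY0 hYne]
          funext k
          exact ite_congr_of_iff (by simp only [if_neg h]) (by simp only [if_neg h, if_pos h'])
        · have hb := hIb ζ (by omega)
          rw [mulVec_vv_barred hY0 hYne hb.1 hb.2]
          funext k
          exact ite_congr_of_iff (by simp only [if_neg h]) (by simp only [if_neg h, if_neg h'])
    · intro ζ η h1 h2 k hk _
      have := hIinc ζ η (Fin.lt_def.2 (by omega))
      have hb := hIb η (by omega)
      simp only [if_neg (not_lt.2 h1), if_neg (show k ≠ r - 1 by omega)]
      refine ⟨by omega, ?_⟩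
      split_ifs <;> rfl
    · refine ite_eq_ite_of_imp ?_ ?_
      · rintro ⟨h1, -, h3, h4, h5, h6⟩ ζ
        refine ⟨?_, fun hζ η hη => ?_⟩
        · split_ifs with h
          · exact h1 ζ h
          · by_cases h' : (ζ : ℕ) + 1 = δ
            · rw [hlast ζ h']
              exact h3 ζ h'
            · have := h4 ζ (by omega)
              have := hIb ζ (by omega)
              omega
        · have hb := hIb η (by omega)
          by_cases h' : (ζ : ℕ) + 1 = δ
          · by_contra hcon
            have := h6 ζ η h' (by omega) (by omega)
            omega
          · have := h5 ζ η (by omega) hη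
            omega
      · intro hall hP
        have hu : ∀ ζ : Fin d, (ζ : ℕ) + 1 < δ → ((Jf ζ : ℕ) = I ζ ∨ (Jf ζ : ℕ) = I ζ + 1) :=
          fun ζ h => by simpa [h] using (hall ζ).1
        have hb : ∀ ζ : Fin d, δ ≤ (ζ : ℕ) + 1 → I ζ ≤ Jf ζ :=
          fun ζ h => by simpa [not_lt.2 h] using (hall ζ).1
        obtain ⟨ζ, η, hη, hlt', hJ⟩ : ∃ ζ η : Fin d, (η : ℕ) < δ ∧ ζ < η ∧ Jf η ≤ Jf ζ := by
          by_contra! hcon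
          refine hP ⟨hu, hcon, fun ζ h => ?_, fun ζ h => ?_, fun ζ η h1 h2 => ?_,
            fun ζ η h1 h2 _ => ?_⟩
          · have := hb ζ h.ge
            rwa [hlast ζ h] at this
          · have := hb ζ (by omega)
            have := hIb ζ h
            omega
          · have := (hall ζ).2 (by omega) η h2
            have := hIb η (by omega)
            omega
          · have := (hall ζ).2 (by omega) η (by omega)
            have := hIb η (by omega)
            omega
        have h0 := Fin.lt_def.1 hlt'
        have h1 := hu ζ (by omega)
        have h2 : I η ≤ Jf η := by
          by_cases h : (η : ℕ) + 1 < δ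
          · have := hu η h
            omega
          · exact hb η (by omega)
        have h3 := hIinc ζ η hlt'
        have h4 := Fin.le_def.1 hJ
        rw [map_vv_eq_zero _ hlt'.ne (by omega), smul_zero]

end CTypeMinors
end
end
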